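/- Let V = W(m,n) ⋉ A d_0 and A = R_m ⊗ Λ. Every simple weight AV-module M of finite rank is a tensor module for W(m,n), M = A ⊗ V' for a simple finite-dimensional gl(m,n)-module V' with support λ + ℤ^m, on which A d_0 acts by multiplication on the left tensor factor: (t^s f d_0)(t^r g ⊗ v) = λ_0 t^{r+s} f g ⊗ v for some scalar λ_0 ∈ ℂ. -/

import Mathlib

open scoped BigOperators

namespace WSuper

noncomputable section

/-- Exponents of the Laurent (even) variables `t_1, …, t_m`. -/
abbrev LExp (m : ℕ) := Fin m → ℤ
/-- Exponents of the Grassmann (odd) variables `ξ_1, …, ξ_n`. -/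
abbrev GExp (n : ℕ) := Fin n → Bool

variable {m n : ℕ}

/-- Degree of a Grassmann monomial `ξ^s`. -/
def gdeg (s : GExp n) : ℕ := (Finset.univ.filter fun a => s a = true).card

/-- Number of inversions between `ξ^s` and `ξ^q`. -/
def invCount (s q : GExp n) : ℕ :=
  ((Finset.univ ×ˢ Finset.univ).filter
    fun p : Fin n × Fin n => s p.1 = true ∧ q p.2 = true ∧ p.2 < p.1).card

/-- The scalar `c` with `ξ^s · ξ^q = c · ξ^(s xor q)` in the exterior algebra. -/
def mulSgn (s q : GExp n) : ℂ :=
  if ∃ a, s a = true ∧ q a = true then 0 else (-1 : ℂ) ^ invCount s q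

/-- Exponent of the product of two (disjoint) Grassmann monomials. -/
def xorE (s q : GExp n) : GExp n := fun a => Bool.xor (s a) (q a)

/-- The scalar `c` with `∂_a (ξ^s) = c ξ^(s \ a)`. -/
def derC (a : Fin n) (s : GExp n) : ℂ :=
  if s a = true then (-1 : ℂ) ^ (Finset.univ.filter fun x => s x = true ∧ x < a).card else 0

/-- The exponent of `∂_a (ξ^s)`. -/
def derE (a : Fin n) (s : GExp n) : GExp n := Function.update s a false

/-- Directions: `d_i = t_i ∂/∂t_i`, `∂_α = ∂/∂ξ_α`, and (when `b = true`) the extra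
even direction `d_0` of `W(m,n) ⋉ A d_0`. -/
inductive Dir (m n : ℕ) : Bool → Type where
  | di {b : Bool} (i : Fin m) : Dir m n b
  | pa {b : Bool} (a : Fin n) : Dir m n b
  | d0 : Dir m n true

/-- The basis `t^r ξ^s D` of `W(m,n)` (for `b = false`) resp. of `W(m,n) ⋉ A d_0`
(for `b = true`). -/
abbrev WBasis (m n : ℕ) (b : Bool) := LExp m × GExp n × Dir m n b

/-- The Lie superalgebra `W(m,n)` (`b = false`) resp. `W(m,n) ⋉ A d_0` (`b = true`),
as the free complex vector space on its standard basis. -/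
abbrev W (m n : ℕ) (b : Bool) := WBasis m n b →₀ ℂ

def sng {b : Bool} (x : WBasis m n b) : W m n b := Finsupp.single x 1

/-- Parity (0 = even, 1 = odd) of a basis element. -/
def par {b : Bool} : WBasis m n b → ℕ
  | ⟨_, s, .di _⟩ => gdeg s % 2
  | ⟨_, s, .pa _⟩ => (gdeg s + 1) % 2
  | ⟨_, s, .d0⟩ => gdeg s % 2

/-- The super Lie bracket of `W(m,n)` (resp. `W(m,n) ⋉ A d_0`) on basis elements. -/
def brB {b : Bool} : WBasis m n b → WBasis m n b → W m n b
  | ⟨r, s, .di i⟩, ⟨p, q, .di j⟩ =>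
      ((p i : ℂ) * mulSgn s q) • sng ⟨r + p, xorE s q, .di j⟩
        - ((r j : ℂ) * mulSgn s q) • sng ⟨r + p, xorE s q, .di i⟩
  | ⟨r, s, .di i⟩, ⟨p, q, .pa β⟩ =>
      ((p i : ℂ) * mulSgn s q) • sng ⟨r + p, xorE s q, .pa β⟩
        - ((-1 : ℂ) ^ (gdeg s * (gdeg q + 1)) * derC β s * mulSgn q (derE β s)) •
            sng ⟨r + p, xorE q (derE β s), .di i⟩
  | ⟨r, s, .pa α⟩, ⟨p, q, .di j⟩ =>
      (derC α q * mulSgn s (derE α q)) • sng ⟨r + p, xorE s (derE α q), .di j⟩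
        - ((-1 : ℂ) ^ ((gdeg s + 1) * gdeg q) * (r j : ℂ) * mulSgn q s) •
            sng ⟨r + p, xorE q s, .pa α⟩
  | ⟨r, s, .pa α⟩, ⟨p, q, .pa β⟩ =>
      (derC α q * mulSgn s (derE α q)) • sng ⟨r + p, xorE s (derE α q), .pa β⟩
        - ((-1 : ℂ) ^ ((gdeg s + 1) * (gdeg q + 1)) * derC β s * mulSgn q (derE β s)) •
            sng ⟨r + p, xorE q (derE β s), .pa α⟩
  | ⟨r, s, .di i⟩, ⟨p, q, .d0⟩ =>
      ((p i : ℂ) * mulSgn s q) • sng ⟨r + p, xorE s q, .d0⟩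
  | ⟨r, s, .pa α⟩, ⟨p, q, .d0⟩ =>
      (derC α q * mulSgn s (derE α q)) • sng ⟨r + p, xorE s (derE α q), .d0⟩
  | ⟨r, s, .d0⟩, ⟨p, q, .di j⟩ =>
      (-(r j : ℂ) * mulSgn s q) • sng ⟨r + p, xorE s q, .d0⟩
  | ⟨r, s, .d0⟩, ⟨p, q, .pa β⟩ =>
      (-(-1 : ℂ) ^ (gdeg s * (gdeg q + 1)) * derC β s * mulSgn q (derE β s)) •
          sng ⟨r + p, xorE q (derE β s), .d0⟩
  | ⟨_, _, .d0⟩, ⟨_, _, .d0⟩ => 0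

/-- A module over the Lie superalgebra `W(m,n)` (resp. `W(m,n) ⋉ A d_0`):
a complex vector space with a linear action satisfying the super commutator rule. -/
structure WRep (m n : ℕ) (b : Bool) where
  M : Type
  [addgrp : AddCommGroup M]
  [mods : Module ℂ M]
  act : W m n b →ₗ[ℂ] M →ₗ[ℂ] M
  super : ∀ x y : WBasis m n b,
    act (brB x y)
      = act (sng x) ∘ₗ act (sng y)
        - ((-1 : ℂ) ^ (par x * par y)) • (act (sng y) ∘ₗ act (sng x))

attribute [instance] WRep.addgrp WRep.mods

/-- A raw action of (the basis of) `W(m,n)` resp. `W(m,n) ⋉ A d_0` on a vector space. -/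
abbrev GAct (m n : ℕ) (b : Bool) (M : Type) [AddCommGroup M] [Module ℂ M] :=
  WBasis m n b → M →ₗ[ℂ] M

/-- Index set for the Cartan subalgebra `h'`: the elements `d_1, …, d_m`,
together with `d_0` when `b = true`. -/
abbrev HIdx (m : ℕ) (b : Bool) := Fin m ⊕ Fin (cond b 1 0)

def hB (m n : ℕ) (b : Bool) : HIdx m b → WBasis m n b :=
  fun h => match b, h with
    | _, .inl i => ⟨0, fun _ => false, .di i⟩
    | true, .inr _ => ⟨0, fun _ => false, .d0⟩
    | false, .inr j => j.elim0

/-- The basis element `ξ_a ∂_a` of the odd Cartan subalgebra `h''`. -/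
def hppB (m n : ℕ) (b : Bool) (a : Fin n) : WBasis m n b :=
  ⟨0, fun x => decide (x = a), .pa a⟩

section Predicates

variable {M : Type} [AddCommGroup M] [Module ℂ M] {b : Bool}

/-- Weight space with respect to the even Cartan subalgebra `h'`. -/
def wtG (F : GAct m n b M) (lam : HIdx m b → ℂ) : Submodule ℂ M :=
  ⨅ h, LinearMap.ker (F (hB m n b h) - lam h • (LinearMap.id : M →ₗ[ℂ] M))

/-- Weight space with respect to the full Cartan subalgebra `h = h' ⊕ h''`. -/
def wtFullG (F : GAct m n b M) (lam : HIdx m b → ℂ) (mu : Fin n → ℂ) : Submodule ℂ M :=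
  wtG F lam ⊓
    ⨅ a, LinearMap.ker (F (hppB m n b a) - mu a • (LinearMap.id : M →ₗ[ℂ] M))

/-- Strong Harish-Chandra module: weight decomposition with respect to `h'`
with finite-dimensional weight spaces. -/
def IsStrongHCG (F : GAct m n b M) : Prop :=
  (⨆ lam, wtG F lam) = ⊤ ∧ ∀ lam, FiniteDimensional ℂ (wtG F lam)

/-- Harish-Chandra module: weight decomposition with respect to `h`
with finite-dimensional weight spaces. -/
def IsHCG (F : GAct m n b M) : Prop :=
  (⨆ lam, ⨆ mu, wtFullG F lam mu) = ⊤ ∧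
    ∀ lam mu, FiniteDimensional ℂ (wtFullG F lam mu)

/-- Strongly cuspidal: strong Harish-Chandra with uniformly bounded multiplicities. -/
def IsStronglyCuspidalG (F : GAct m n b M) : Prop :=
  IsStrongHCG F ∧ ∃ C : ℕ, ∀ lam, Module.finrank ℂ (wtG F lam) ≤ C

/-- Cuspidal: Harish-Chandra with uniformly bounded weight multiplicities. -/
def IsCuspidalG (F : GAct m n b M) : Prop :=
  IsHCG F ∧ ∃ C : ℕ, ∀ lam mu, Module.finrank ℂ (wtFullG F lam mu) ≤ C

/-- The action of the odd Cartan subalgebra `h''` is diagonalizable. -/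
def DiagHppG (F : GAct m n b M) : Prop :=
  (⨆ mu : Fin n → ℂ,
    ⨅ a, LinearMap.ker (F (hppB m n b a) - mu a • (LinearMap.id : M →ₗ[ℂ] M))) = ⊤

def InvariantG (F : GAct m n b M) (N : Submodule ℂ M) : Prop :=
  ∀ x : WBasis m n b, ∀ v ∈ N, F x v ∈ N

/-- Simplicity of a module, phrased via invariant subspaces. -/
def IsSimpleG (F : GAct m n b M) : Prop :=
  (∃ v : M, v ≠ 0) ∧ ∀ N : Submodule ℂ M, InvariantG F N → N = ⊥ ∨ N = ⊤

end Predicates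

/-- The action of basis elements attached to a representation. -/
def WRep.g {b : Bool} (ρ : WRep m n b) : GAct m n b ρ.M := fun x => ρ.act (sng x)

end

end WSuper

namespace WSuper

noncomputable section

variable {m n : ℕ}

/-- Basis monomials `t^r ξ^s` of the supercommutative superalgebra `A = R_m ⊗ Λ`. -/
abbrev ABasis (m n : ℕ) := LExp m × GExp n

/-- The supercommutative superalgebra `A = R_m ⊗ Λ` as the free complex vector
space on its monomial basis. -/
abbrev AAlg (m n : ℕ) := ABasis m n →₀ ℂ

def asng (x : ABasis m n) : AAlg m n := Finsupp.single x 1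

def aone (m n : ℕ) : AAlg m n := asng (0, fun _ => false)

/-- Product of two monomials of `A`. -/
def amulB (x y : ABasis m n) : AAlg m n :=
  mulSgn x.2 y.2 • asng (x.1 + y.1, xorE x.2 y.2)

/-- Parity of a monomial of `A`. -/
def apar (x : ABasis m n) : ℕ := gdeg x.2 % 2

/-- The action of a basis element of `W(m,n)` (resp. `W(m,n) ⋉ A d_0`) on a
monomial of `A` by superderivations (`d_0` acts by zero on `A`). -/
def wOnA {b : Bool} : WBasis m n b → ABasis m n → AAlg m n
  | ⟨r, s, .di i⟩, ⟨p, q⟩ => ((p i : ℂ) * mulSgn s q) • asng (r + p, xorE s q)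
  | ⟨r, s, .pa α⟩, ⟨p, q⟩ =>
      (derC α q * mulSgn s (derE α q)) • asng (r + p, xorE s (derE α q))
  | ⟨_, _, .d0⟩, _ => 0

/-- An `AV`-module: compatible actions of the superalgebra `A` and of the Lie
superalgebra `V = W(m,n)` (resp. `W(m,n) ⋉ A d_0`), satisfying the Leibniz rule. -/
structure AVRep (m n : ℕ) (b : Bool) extends WRep m n b where
  aact : AAlg m n →ₗ[ℂ] M →ₗ[ℂ] M
  aact_one : aact (aone m n) = LinearMap.id
  aact_mul : ∀ x y : ABasis m n, aact (amulB x y) = aact (asng x) ∘ₗ aact (asng y)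
  leibniz : ∀ (x : WBasis m n b) (f : ABasis m n),
    act (sng x) ∘ₗ aact (asng f)
      = aact (wOnA x f)
        + ((-1 : ℂ) ^ (par x * apar f)) • (aact (asng f) ∘ₗ act (sng x))

/-- `M` is finitely generated as an `A`-module. -/
def IsFiniteRank {b : Bool} (ρ : AVRep m n b) : Prop :=
  ∃ S : Finset ρ.M,
    Submodule.span ℂ {v : ρ.M | ∃ f : ABasis m n, ∃ s ∈ S, v = ρ.aact (asng f) s} = ⊤

/-- A subspace invariant under both the `A`-action and the `V`-action. -/
def AVInvariant {b : Bool} (ρ : AVRep m n b) (N : Submodule ℂ ρ.M) : Prop :=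
  InvariantG ρ.g N ∧ ∀ f : ABasis m n, ∀ v ∈ N, ρ.aact (asng f) v ∈ N

/-- Irreducibility as an `AV`-module. -/
def AVIsSimple {b : Bool} (ρ : AVRep m n b) : Prop :=
  (∃ v : ρ.M, v ≠ 0) ∧ ∀ N : Submodule ℂ ρ.M, AVInvariant ρ N → N = ⊥ ∨ N = ⊤

/-- A weight module: weight decomposition with respect to `h'`. -/
def IsWeightG {M : Type} [AddCommGroup M] [Module ℂ M] {b : Bool}
    (F : GAct m n b M) : Prop :=
  (⨆ lam, wtG F lam) = ⊤

end

end WSuper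

namespace WSuper

noncomputable section

variable {m n : ℕ}

/-- Index set for the standard basis `e_{xy}` of `gl(m,n)`. -/
abbrev GlIdx (m n : ℕ) := Fin m ⊕ Fin n

/-- Parity of an index of `gl(m,n)`. -/
def gpar : GlIdx m n → ℕ
  | .inl _ => 0
  | .inr _ => 1

/-- A module over the Lie superalgebra `gl(m,n)`, given by the action of the
standard basis elements `e_{xy}` subject to the super commutator relations. -/
structure GlRep (m n : ℕ) where
  V : Type
  [addgrp : AddCommGroup V]
  [mods : Module ℂ V]
  ρ : GlIdx m n → GlIdx m n → Module.End ℂ V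
  rel : ∀ x y z w : GlIdx m n,
    ρ x y * ρ z w
        - ((-1 : ℂ) ^ ((gpar x + gpar y) * (gpar z + gpar w))) • (ρ z w * ρ x y)
      = (if y = z then ρ x w else 0)
        - ((-1 : ℂ) ^ ((gpar x + gpar y) * (gpar z + gpar w))) •
            (if w = x then ρ z y else 0)

attribute [instance] GlRep.addgrp GlRep.mods

/-- Irreducibility of a `gl(m,n)`-module. -/
def GlRep.IsSimple (σ : GlRep m n) : Prop :=
  (∃ v : σ.V, v ≠ 0) ∧
    ∀ N : Submodule ℂ σ.V, (∀ x y, ∀ v ∈ N, σ.ρ x y v ∈ N) → N = ⊥ ∨ N = ⊤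

/-- The carrier `A ⊗ V` of a tensor module. -/
abbrev TModule (σ : GlRep m n) := ABasis m n →₀ σ.V

/-- The action of `W(m,n)` (resp. `W(m,n) ⋉ A d_0`, where `f d_0` acts as
multiplication by `λ_0 f`) on the tensor module `T(V, λ) = A ⊗ V`:
`(t^s f d_j)(t^r g ⊗ v) = (r_j + λ_j) t^{r+s} f g ⊗ v
  + Σ_i s_i t^{r+s} f ⊗ ρ(e_{ij}) g·v + Σ_α t^{r+s} (f)∂*_α ⊗ ρ(e_{αj}) g·v`,
`(t^s f ∂_β)(t^r g ⊗ v) = t^{r+s} f (∂g/∂ξ_β) ⊗ v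
  + Σ_i s_i t^{r+s} f ⊗ ρ(e_{iβ}) g·v + Σ_α t^{r+s} (f)∂*_α ⊗ ρ(e_{αβ}) g·v`,
with `(f)∂*_α = (−1)^{|f|+1} ∂_α(f)` and the usual Koszul signs for applying an
operator `a ⊗ ρ(e)` with `e` odd to `g ⊗ v`. -/
def tmAct (σ : GlRep m n) (lam : Fin m → ℂ) (lam0 : ℂ) {b : Bool} :
    WBasis m n b → TModule σ → TModule σ
  | ⟨s, f, .di j⟩, u => u.sum fun rc v =>
      ((((rc.1 j : ℂ) + lam j) * mulSgn f rc.2) •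
          Finsupp.single (rc.1 + s, xorE f rc.2) v)
      + (∑ i : Fin m, ((s i : ℂ) * mulSgn f rc.2) •
          Finsupp.single (rc.1 + s, xorE f rc.2) (σ.ρ (.inl i) (.inl j) v))
      + (∑ α : Fin n,
          ((-1 : ℂ) ^ gdeg rc.2 * ((-1 : ℂ) ^ (gdeg f + 1) * derC α f) *
              mulSgn (derE α f) rc.2) •
            Finsupp.single (rc.1 + s, xorE (derE α f) rc.2) (σ.ρ (.inr α) (.inl j) v))
  | ⟨s, f, .pa β⟩, u => u.sum fun rc v =>
      ((derC β rc.2 * mulSgn f (derE β rc.2)) •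
          Finsupp.single (rc.1 + s, xorE f (derE β rc.2)) v)
      + (∑ i : Fin m, ((-1 : ℂ) ^ gdeg rc.2 * (s i : ℂ) * mulSgn f rc.2) •
          Finsupp.single (rc.1 + s, xorE f rc.2) (σ.ρ (.inl i) (.inr β) v))
      + (∑ α : Fin n,
          (((-1 : ℂ) ^ (gdeg f + 1) * derC α f) * mulSgn (derE α f) rc.2) •
            Finsupp.single (rc.1 + s, xorE (derE α f) rc.2) (σ.ρ (.inr α) (.inr β) v))
  | ⟨s, f, .d0⟩, u => u.sum fun rc v =>
      (lam0 * mulSgn f rc.2) • Finsupp.single (rc.1 + s, xorE f rc.2) v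

/-- The action of `A` on the tensor module `A ⊗ V` by multiplication on the
left tensor factor. -/
def tmA {σ : GlRep m n} (x : ABasis m n) (u : TModule σ) : TModule σ :=
  u.sum fun rc v => mulSgn x.2 rc.2 • Finsupp.single (x.1 + rc.1, xorE x.2 rc.2) v

end

end WSuper

namespace WSuper

/-! ### Combinatorics of Grassmann monomials -/

section Grassmann

variable {m n : ℕ}

/-- The exponent of the Grassmann monomial `1`. -/
def gnil : GExp n := fun _ => false

/-- The exponent of the Grassmann monomial `ξ_a`. -/
def gone (a : Fin n) : GExp n := fun x => decide (x = a)

/-- The augmentation of a Grassmann monomial. -/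
noncomputable def gaug (q : GExp n) : ℂ := if q = gnil then 1 else 0

@[simp] lemma gaug_gnil : gaug (gnil : GExp n) = 1 := if_pos rfl

lemma gaug_of_ne {q : GExp n} (h : q ≠ gnil) : gaug q = 0 := if_neg h

@[simp] lemma gdeg_gnil : gdeg (gnil : GExp n) = 0 := by simp [gdeg, gnil]

@[simp] lemma gdeg_gone (a : Fin n) : gdeg (gone a) = 1 := by
  simp only [gdeg, gone, decide_eq_true_eq]
  rw [Finset.filter_eq' Finset.univ a, if_pos (Finset.mem_univ a), Finset.card_singleton]

lemma gdeg_eq_zero_iff {q : GExp n} : gdeg q = 0 ↔ q = gnil := by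
  simp [gdeg, funext_iff, gnil, Finset.filter_eq_empty_iff]

lemma gone_ne_gnil (a : Fin n) : gone a ≠ gnil := fun h => by
  have := congrArg gdeg h
  simp at this

lemma gone_injective : Function.Injective (gone : Fin n → GExp n) := fun a b h => by
  simpa [gone] using congrFun h a

lemma gdeg_eq_one_iff {q : GExp n} : gdeg q = 1 ↔ ∃ a, q = gone a := by
  constructor
  · intro h
    obtain ⟨a, ha⟩ := Finset.card_eq_one.mp h
    refine ⟨a, funext fun x => ?_⟩
    have := congrArg (x ∈ ·) ha
    simp at this
    by_cases hx : x = a <;> simp_all [gone]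
  · rintro ⟨a, rfl⟩
    simp

@[simp] lemma xorE_gnil (q : GExp n) : xorE q gnil = q := by
  funext a; simp [xorE, gnil]

@[simp] lemma gnil_xorE (q : GExp n) : xorE gnil q = q := by
  funext a; simp [xorE, gnil]

lemma xorE_comm (q r : GExp n) : xorE q r = xorE r q := by
  funext a; simp [xorE, Bool.xor_comm]

lemma xorE_eq_gnil_iff {q r : GExp n} : xorE q r = gnil ↔ q = r := by
  simp [funext_iff, xorE, gnil]

@[simp] lemma mulSgn_gnil (q : GExp n) : mulSgn q gnil = 1 := by
  simp [mulSgn, invCount, gnil]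

@[simp] lemma gnil_mulSgn (q : GExp n) : mulSgn gnil q = 1 := by
  simp [mulSgn, invCount, gnil]

lemma invCount_add_invCount {q r : GExp n} (h : ¬ ∃ a, q a = true ∧ r a = true) :
    invCount q r + invCount r q = gdeg q * gdeg r := by
  classical
  have h1 : invCount r q = ((Finset.univ ×ˢ Finset.univ).filter
      fun p : Fin n × Fin n => q p.1 = true ∧ r p.2 = true ∧ p.1 < p.2).card := by
    refine Finset.card_bij' (fun p _ => p.swap) (fun p _ => p.swap) ?_ ?_ ?_ ?_ <;>
      simp +contextual
  rw [h1, invCount, ← Finset.card_union_of_disjoint, gdeg, gdeg, ← Finset.card_product]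
  · congr 1
    ext ⟨a, b⟩
    simp only [Finset.mem_union, Finset.mem_filter, Finset.mem_product, Finset.mem_univ, true_and]
    constructor
    · tauto
    · rintro ⟨ha, hb⟩
      have hne : a ≠ b := fun hab => h ⟨a, ha, hab ▸ hb⟩
      rcases lt_or_gt_of_ne hne with hlt | hlt <;> tauto
  · rw [Finset.disjoint_left]
    rintro ⟨a, b⟩ h1 h2
    simp only [Finset.mem_filter] at h1 h2
    exact absurd h1.2.2.2 (not_lt.mpr h2.2.2.2.le)

lemma mulSgn_swap (q r : GExp n) :
    mulSgn q r = (-1) ^ (gdeg q * gdeg r) * mulSgn r q := by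
  unfold mulSgn
  by_cases h : ∃ a, q a = true ∧ r a = true
  · have h' : ∃ a, r a = true ∧ q a = true := by simpa [and_comm] using h
    simp [h, h']
  · have h' : ¬ ∃ a, r a = true ∧ q a = true := by simpa [and_comm] using h
    rw [if_neg h, if_neg h', ← invCount_add_invCount h, pow_add, mul_assoc, ← mul_pow]
    simp

lemma mulSgn_mul_gaug (q r : GExp n) : mulSgn q r * gaug (xorE q r) = gaug q * gaug r := by
  unfold gaug
  simp only [xorE_eq_gnil_iff]
  by_cases h : q = r
  · subst h
    by_cases hq : q = gnil
    · subst hq; simp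
    · have : ∃ a, q a = true := by
        by_contra! hc
        exact hq (funext fun a => by simpa [gnil] using hc a)
      simp [hq, mulSgn, this]
  · by_cases hq : q = gnil
    · subst hq
      simp [h, Ne.symm h]
    · simp [h, hq]

lemma derC_of_false {a : Fin n} {q : GExp n} (h : q a = false) : derC a q = 0 := by
  simp [derC, h]

lemma derC_mul_self {a : Fin n} {q : GExp n} (h : q a = true) : derC a q * derC a q = 1 := by
  simp [derC, h, ← mul_pow]

lemma derC_ne_zero {a : Fin n} {q : GExp n} (h : q a = true) : derC a q ≠ 0 := fun h0 => by
  simpa [h0] using derC_mul_self h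

@[simp] lemma derC_gnil (a : Fin n) : derC a (gnil : GExp n) = 0 := derC_of_false rfl

@[simp] lemma derC_gone_self (a : Fin n) : derC a (gone a) = 1 := by
  have : (Finset.univ.filter fun x => gone a x = true ∧ x < a) = ∅ := by
    simp +contextual [Finset.filter_eq_empty_iff, gone]
  simp [derC, this]
  simp [gone]

lemma derC_gone_of_ne {a b : Fin n} (h : a ≠ b) : derC a (gone b) = 0 :=
  derC_of_false (by simp [gone, h])

@[simp] lemma derE_gone_self (a : Fin n) : derE a (gone a) = gnil := by
  funext x
  by_cases h : x = a <;> simp [derE, gone, gnil, h]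

lemma gdeg_derE {a : Fin n} {q : GExp n} (h : q a = true) : gdeg (derE a q) + 1 = gdeg q := by
  have : (Finset.univ.filter fun x => derE a q x = true)
      = (Finset.univ.filter fun x => q x = true).erase a := by
    ext x
    by_cases hx : x = a <;> simp [derE, Function.update_apply, hx]
  rw [gdeg, this, Finset.card_erase_add_one (by simpa using h)]
  rfl

lemma xorE_gone_derE {a : Fin n} {q : GExp n} (h : q a = true) :
    xorE (gone a) (derE a q) = q := by
  funext x
  by_cases hx : x = a
  · subst hx; simp [xorE, gone, derE, h]
  · simp [xorE, gone, derE, hx]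

lemma derC_mul_mulSgn {a : Fin n} {q : GExp n} (h : q a = true) :
    derC a q * mulSgn (gone a) (derE a q) = 1 := by
  have h1 : invCount (gone a) (derE a q)
      = (Finset.univ.filter fun x => q x = true ∧ x < a).card := by
    unfold invCount
    refine Finset.card_bij' (fun p _ => p.2) (fun x _ => (a, x)) ?_ ?_ ?_ ?_
    · rintro ⟨x, y⟩ hp
      simp only [Finset.mem_filter, gone, decide_eq_true_eq, derE] at hp ⊢
      obtain ⟨-, rfl, hq, hlt⟩ := hp
      rw [Function.update_of_ne hlt.ne] at hq
      exact ⟨Finset.mem_univ _, hq, hlt⟩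
    · intro x hx
      simp only [Finset.mem_filter] at hx
      simp [gone, derE, Function.update_of_ne hx.2.2.ne, hx]
    · rintro ⟨x, y⟩ hp
      simp only [Finset.mem_filter, gone, decide_eq_true_eq] at hp
      simp [hp.2.1]
    · intro x hx
      rfl
  have h2 : ¬ ∃ b, gone a b = true ∧ derE a q b = true := by
    rintro ⟨b, hb, hb'⟩
    simp only [gone, decide_eq_true_eq] at hb
    subst hb
    simp [derE] at hb'
  rw [mulSgn, if_neg h2, h1, derC, if_pos h, ← mul_pow]
  simp

lemma derE_comm (a b : Fin n) (q : GExp n) : derE a (derE b q) = derE b (derE a q) := by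
  by_cases h : a = b
  · rw [h]
  · exact (Function.update_comm h false false q).symm

lemma derE_apply_self (a : Fin n) (q : GExp n) : derE a q a = false := by simp [derE]

lemma derE_apply_of_ne {a b : Fin n} (h : b ≠ a) (q : GExp n) : derE a q b = q b := by
  simp [derE, h]

lemma derC_derE_of_lt {a b : Fin n} (h : a < b) {q : GExp n} (ha : q a = true) :
    derC b (derE a q) = - derC b q := by
  by_cases hb : q b = true
  · have hset : (Finset.univ.filter fun x => derE a q x = true ∧ x < b)
        = (Finset.univ.filter fun x => q x = true ∧ x < b).erase a := by
      ext x
      by_cases hx : x = a <;> simp [derE, Function.update_apply, hx]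
    have hmem : a ∈ Finset.univ.filter fun x => q x = true ∧ x < b := by simp [ha, h]
    rw [derC, derC, if_pos hb, if_pos (by rwa [derE_apply_of_ne h.ne']), hset,
      ← Finset.card_erase_add_one hmem, pow_succ]
    simp
  · have hb' : q b = false := by simpa using hb
    rw [derC_of_false hb', derC_of_false (by rwa [derE_apply_of_ne h.ne']), neg_zero]

lemma derC_derE_of_gt {a b : Fin n} (h : b < a) (q : GExp n) :
    derC b (derE a q) = derC b q := by
  have hset : (Finset.univ.filter fun x => derE a q x = true ∧ x < b)
      = (Finset.univ.filter fun x => q x = true ∧ x < b) := by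
    ext x
    by_cases hx : x = a
    · subst hx; simp [h.not_gt]
    · simp [derE_apply_of_ne hx]
  rw [derC, derC, hset, derE_apply_of_ne h.ne]

lemma derC_mul_derC_derE (a b : Fin n) (q : GExp n) :
    derC a q * derC b (derE a q) = - (derC b q * derC a (derE b q)) := by
  by_cases ha : q a = true
  swap
  · have ha' : q a = false := by simpa using ha
    have h2 : derE b q a = false := by
      by_cases h : a = b
      · subst h; exact derE_apply_self _ _
      · rwa [derE_apply_of_ne h]
    rw [derC_of_false ha', derC_of_false h2]; simp
  by_cases hb : q b = true
  swap
  · have hb' : q b = false := by simpa using hb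
    have h2 : derE a q b = false := by
      by_cases h : b = a
      · subst h; exact derE_apply_self _ _
      · rwa [derE_apply_of_ne h]
    rw [derC_of_false hb', derC_of_false h2]; simp
  rcases lt_trichotomy a b with h | h | h
  · rw [derC_derE_of_lt h ha, derC_derE_of_gt h]; ring
  · subst h
    rw [derC_of_false (derE_apply_self _ _)]; simp
  · rw [derC_derE_of_lt h hb, derC_derE_of_gt h]; ring

lemma neg_one_pow_gdeg_xorE (q r : GExp n) :
    (-1 : ℂ) ^ gdeg (xorE q r) = (-1) ^ (gdeg q + gdeg r) := by
  classical
  have key : ∀ s : GExp n, (-1 : ℂ) ^ gdeg s = ∏ a, if s a = true then (-1 : ℂ) else 1 := by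
    intro s
    rw [Finset.prod_ite]
    simp [gdeg]
  rw [pow_add, key, key, key, ← Finset.prod_mul_distrib]
  refine Finset.prod_congr rfl fun a _ => ?_
  cases hq : q a <;> cases hr : r a <;> simp [xorE, hq, hr]

end Grassmann

/-! ### Graded families of operators on a finite-dimensional space -/

section Graded

variable {V : Type*} [AddCommGroup V] [Module ℂ V]

/-- The elements of `L` of degree `c` with respect to the commutator with `E`. -/
def gradedPart (E : Module.End ℂ V) (L : Submodule ℂ (Module.End ℂ V)) (c : ℕ) :
    Submodule ℂ (Module.End ℂ V) where
  carrier := {Y | Y ∈ L ∧ E * Y - Y * E = (c : ℂ) • Y}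
  add_mem' := by
    rintro X Y ⟨hX, hX'⟩ ⟨hY, hY'⟩
    refine ⟨L.add_mem hX hY, ?_⟩
    rw [smul_add, ← hX', ← hY']
    noncomm_ring
  zero_mem' := ⟨L.zero_mem, by simp⟩
  smul_mem' := by
    rintro z X ⟨hX, hX'⟩
    refine ⟨L.smul_mem z hX, ?_⟩
    rw [smul_comm, ← hX', smul_sub, mul_smul_comm, smul_mul_assoc]

/-- The span of the elements of `L` of positive degree. -/
def positivePart (E : Module.End ℂ V) (L : Submodule ℂ (Module.End ℂ V)) :
    Submodule ℂ (Module.End ℂ V) :=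
  ⨆ c : ℕ, gradedPart E L (c + 1)

lemma gradedPart_succ_le (E : Module.End ℂ V) (L : Submodule ℂ (Module.End ℂ V)) (c : ℕ) :
    gradedPart E L (c + 1) ≤ positivePart E L :=
  le_iSup (fun c : ℕ => gradedPart E L (c + 1)) c

lemma commutator_mem_positivePart {E : Module.End ℂ V} {L : Submodule ℂ (Module.End ℂ V)}
    (hL : L ≤ ⨆ c, gradedPart E L c) {Z : Module.End ℂ V} (hZ : Z ∈ L) :
    E * Z - Z * E ∈ positivePart E L := by
  refine Submodule.iSup_induction (gradedPart E L)
    (motive := fun Z => E * Z - Z * E ∈ positivePart E L) (hL hZ) ?_ (by simp) ?_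
  · rintro (_ | c) Y hY
    · have := hY.2
      rw [this]
      simp
    · rw [hY.2]
      exact Submodule.smul_mem _ _ (gradedPart_succ_le E L c hY)
  · intro X Y hX hY
    have : E * (X + Y) - (X + Y) * E = (E * X - X * E) + (E * Y - Y * E) := by noncomm_ring
    rw [this]
    exact add_mem hX hY

/-- If the commutator with `E` maps `Z` to `k Z` up to terms of degree `< k`, then `Z` is a sum of
terms of degree `≤ k`. -/
lemma mem_iSup_gradedPart_of_commutator {E : Module.End ℂ V}
    {L : Submodule ℂ (Module.End ℂ V)} {k : ℕ} {Z : Module.End ℂ V} (hZ : Z ∈ L)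
    (h : E * Z - Z * E - (k : ℂ) • Z ∈ ⨆ c : Fin k, gradedPart E L c) :
    Z ∈ ⨆ c : Fin (k + 1), gradedPart E L c := by
  have key : ∀ U ∈ ⨆ c : Fin k, gradedPart E L c, ∃ U' ∈ ⨆ c : Fin k, gradedPart E L c,
      U' ∈ L ∧ E * U' - U' * E - (k : ℂ) • U' = U := by
    intro U hU
    refine Submodule.iSup_induction (fun c : Fin k => gradedPart E L c)
      (motive := fun U => ∃ U' ∈ ⨆ c : Fin k, gradedPart E L c,
        U' ∈ L ∧ E * U' - U' * E - (k : ℂ) • U' = U) hU ?_ ⟨0, by simp⟩ ?_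
    · intro c Y hY
      have hne : ((c : ℕ) : ℂ) - k ≠ 0 := by
        rw [sub_ne_zero]
        exact_mod_cast c.2.ne
      refine ⟨(((c : ℕ) : ℂ) - k)⁻¹ • Y, Submodule.smul_mem _ _
        (Submodule.mem_iSup_of_mem c hY), L.smul_mem _ hY.1, ?_⟩
      rw [mul_smul_comm, smul_mul_assoc, ← smul_sub, hY.2, smul_smul, smul_smul, ← sub_smul]
      rw [show (((c : ℕ) : ℂ) - k)⁻¹ * ((c : ℕ) : ℂ) - k * (((c : ℕ) : ℂ) - k)⁻¹ = 1 by
        field_simp, one_smul]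
    · rintro X Y ⟨X', h1, h2, h3⟩ ⟨Y', h4, h5, h6⟩
      refine ⟨X' + Y', add_mem h1 h4, add_mem h2 h5, ?_⟩
      rw [← h3, ← h6, smul_add]
      noncomm_ring
  have hle : (⨆ c : Fin k, gradedPart E L c) ≤ ⨆ c : Fin (k + 1), gradedPart E L c :=
    iSup_le fun c => le_iSup (fun c : Fin (k + 1) => gradedPart E L c) c.castSucc
  obtain ⟨U, hU, hUL, hU'⟩ := key _ h
  have h1 : Z - U ∈ gradedPart E L k := by
    refine ⟨L.sub_mem hZ hUL, ?_⟩
    rw [sub_eq_iff_eq_add] at hU'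
    have : E * (Z - U) - (Z - U) * E = (E * Z - Z * E) - (E * U - U * E) := by noncomm_ring
    rw [this, hU', smul_sub]
    abel
  have h2 : Z - U ∈ ⨆ c : Fin (k + 1), gradedPart E L c :=
    Submodule.mem_iSup_of_mem (Fin.last k) (by simpa using h1)
  simpa using add_mem h2 (hle hU)

/-- The sum of the generalized eigenspaces of `E` with eigenvalues of real part `≥ a`. -/
def eigFiltration (E : Module.End ℂ V) (a : ℝ) : Submodule ℂ V :=
  ⨆ μ : {μ : ℂ // a ≤ μ.re}, E.maxGenEigenspace μ

lemma mapsTo_maxGenEigenspace_of_commutator {E Y : Module.End ℂ V} {c : ℂ}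
    (h : E * Y - Y * E = c • Y) {μ : ℂ} {v : V} (hv : v ∈ E.maxGenEigenspace μ) :
    Y v ∈ E.maxGenEigenspace (μ + c) := by
  rw [Module.End.mem_maxGenEigenspace] at hv ⊢
  obtain ⟨k, hk⟩ := hv
  refine ⟨k, ?_⟩
  have h1 : SemiconjBy Y (E - μ • 1) (E - (μ + c) • 1) := by
    rw [SemiconjBy, mul_sub, sub_mul, add_smul, add_mul, smul_one_mul, smul_one_mul,
      mul_smul_comm, mul_one, ← h]
    abel
  have h2 := (h1.pow_right k).eq
  rw [← Module.End.mul_apply, ← h2, Module.End.mul_apply, hk, map_zero]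

lemma positivePart_eigFiltration {E : Module.End ℂ V} {L : Submodule ℂ (Module.End ℂ V)}
    {Y : Module.End ℂ V} (hY : Y ∈ positivePart E L) {a : ℝ} {v : V}
    (hv : v ∈ eigFiltration E a) : Y v ∈ eigFiltration E (a + 1) := by
  refine Submodule.iSup_induction (fun c : ℕ => gradedPart E L (c + 1))
    (motive := fun Y => Y v ∈ eigFiltration E (a + 1)) hY ?_ (by simp) ?_
  · intro c Y hY
    refine Submodule.iSup_induction
      (fun μ : {μ : ℂ // a ≤ μ.re} => E.maxGenEigenspace (μ : ℂ))
      (motive := fun v => Y v ∈ eigFiltration E (a + 1)) hv ?_ (by simp) ?_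
    · rintro ⟨μ, hμ⟩ w hw
      have := mapsTo_maxGenEigenspace_of_commutator hY.2 hw
      refine Submodule.mem_iSup_of_mem (⟨μ + ((c + 1 : ℕ) : ℂ), ?_⟩ : {μ : ℂ // a + 1 ≤ μ.re}) this
      have : (0 : ℝ) ≤ c := Nat.cast_nonneg c
      simp
      linarith
    · intro x y hx hy
      rw [map_add]
      exact add_mem hx hy
  · intro X Y hX hY
    exact add_mem hX hY

lemma exists_eigFiltration_bounds [FiniteDimensional ℂ V] (E : Module.End ℂ V) :
    ∃ (a : ℝ) (K : ℕ), eigFiltration E a = ⊤ ∧ eigFiltration E (a + K) = ⊥ := by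
  have hfin : (spectrum ℂ E).Finite := Module.End.finite_spectrum E
  obtain ⟨R, hR⟩ := hfin.isBounded.exists_norm_le
  have hre : ∀ μ, E.maxGenEigenspace μ ≠ ⊥ → |μ.re| ≤ R := by
    intro μ hμ
    refine (Complex.abs_re_le_norm μ).trans (hR μ ?_)
    rw [← Module.End.hasEigenvalue_iff_mem_spectrum]
    exact (Module.End.hasUnifEigenvalue_iff_hasUnifEigenvalue_one (k := ⊤) (by simp)).1 hμ
  obtain ⟨K, hK⟩ := exists_nat_gt (2 * R)
  refine ⟨-R, K, ?_, ?_⟩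
  · rw [eq_top_iff, ← Module.End.iSup_maxGenEigenspace_eq_top E]
    refine iSup_le fun μ => ?_
    by_cases h : E.maxGenEigenspace μ = ⊥
    · rw [h]; exact bot_le
    · exact le_iSup (fun μ : {μ : ℂ // -R ≤ μ.re} => E.maxGenEigenspace (μ : ℂ))
        ⟨μ, (abs_le.mp (hre μ h)).1⟩
  · rw [eq_bot_iff]
    refine iSup_le ?_
    rintro ⟨μ, hμ⟩
    by_contra h
    have h' : E.maxGenEigenspace μ ≠ ⊥ := fun h0 => h h0.le
    have := (abs_le.mp (hre μ h')).2
    linarith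

lemma eq_zero_of_positivePart_eigenvector [FiniteDimensional ℂ V] {E : Module.End ℂ V}
    {L : Submodule ℂ (Module.End ℂ V)} {Y : Module.End ℂ V} (hY : Y ∈ positivePart E L)
    {c : ℂ} (hc : c ≠ 0) {w : V} (hw : Y w = c • w) : w = 0 := by
  obtain ⟨a, K, h1, h2⟩ := exists_eigFiltration_bounds E
  have h : ∀ k : ℕ, w ∈ eigFiltration E (a + k) := by
    intro k
    induction k with
    | zero => simp [h1]
    | succ k ih =>
      have := positivePart_eigFiltration hY ih
      rw [hw] at this
      rw [← inv_smul_smul₀ hc w]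
      push_cast
      rw [← add_assoc]
      exact Submodule.smul_mem _ _ this
  simpa [h2] using h K

/-- The vectors killed by all operators of positive degree. -/
def positiveInvariants (E : Module.End ℂ V) (L : ℕ → Submodule ℂ (Module.End ℂ V)) :
    Submodule ℂ V :=
  ⨅ a, ⨅ Y : positivePart E (L a), LinearMap.ker (Y : Module.End ℂ V)

lemma mem_positiveInvariants {E : Module.End ℂ V} {L : ℕ → Submodule ℂ (Module.End ℂ V)}
    {v : V} : v ∈ positiveInvariants E L ↔ ∀ a, ∀ Y ∈ positivePart E (L a), Y v = 0 := by
  simp [positiveInvariants]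

lemma positiveInvariants_ne_bot [FiniteDimensional ℂ V] [Nontrivial V] (E : Module.End ℂ V)
    (L : ℕ → Submodule ℂ (Module.End ℂ V)) : positiveInvariants E L ≠ ⊥ := by
  classical
  obtain ⟨a, K, h1, h2⟩ := exists_eigFiltration_bounds E
  have hex : ∃ k : ℕ, eigFiltration E (a + k) = ⊥ := ⟨K, h2⟩
  have hpos : Nat.find hex ≠ 0 := by
    intro h0
    have := Nat.find_spec hex
    rw [h0] at this
    simp [h1] at this
  obtain ⟨k, hk⟩ := Nat.exists_eq_succ_of_ne_zero hpos
  have hbot : eigFiltration E (a + k + 1) = ⊥ := by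
    have := Nat.find_spec hex
    rw [hk] at this
    push_cast at this
    rwa [← add_assoc] at this
  have hne : eigFiltration E (a + k) ≠ ⊥ := Nat.find_min hex (by omega)
  refine fun hN => hne (eq_bot_iff.mpr fun v hv => ?_)
  rw [← hN, mem_positiveInvariants]
  intro b Y hY
  simpa [hbot] using positivePart_eigFiltration hY hv

lemma apply_mem_positiveInvariants {E : Module.End ℂ V}
    {L : ℕ → Submodule ℂ (Module.End ℂ V)} (hL : ∀ a, L a ≤ ⨆ c, gradedPart E (L a) c)
    (hbr : ∀ a b, ∀ X ∈ L a, ∀ Y ∈ L b, X * Y - (-1 : ℂ) ^ (a * b) • (Y * X) ∈ L (a + b))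
    {b : ℕ} {Z : Module.End ℂ V} (hZ : Z ∈ L b) {v : V} (hv : v ∈ positiveInvariants E L) :
    Z v ∈ positiveInvariants E L := by
  have hv' := mem_positiveInvariants.mp hv
  refine Submodule.iSup_induction (gradedPart E (L b))
    (motive := fun Z => Z v ∈ positiveInvariants E L) (hL b hZ) ?_ (by simp) ?_
  · intro c' Z hZ
    refine mem_positiveInvariants.mpr fun a Y hY => ?_
    refine Submodule.iSup_induction (fun c : ℕ => gradedPart E (L a) (c + 1))
      (motive := fun Y => Y (Z v) = 0) hY ?_ (by simp) ?_
    · intro c Y hY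
      have h1 : Y * Z - (-1 : ℂ) ^ (a * b) • (Z * Y) ∈ gradedPart E (L (a + b)) (c + c' + 1) := by
        refine ⟨hbr a b Y hY.1 Z hZ.1, ?_⟩
        have e1 : E * Y = Y * E + ((c + 1 : ℕ) : ℂ) • Y := by rw [← hY.2]; abel
        have e2 : E * Z = Z * E + (c' : ℂ) • Z := by rw [← hZ.2]; abel
        rw [mul_sub, sub_mul, mul_smul_comm, smul_mul_assoc, ← mul_assoc, e1, ← mul_assoc, e2,
          add_mul, add_mul, mul_assoc Y E Z, e2, mul_assoc Z E Y, e1]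
        simp only [mul_add, mul_smul_comm, smul_mul_assoc, ← mul_assoc]
        push_cast
        module
      have h2 := hv' _ _ (gradedPart_succ_le _ _ _ h1)
      have h3 := hv' a Y (gradedPart_succ_le _ _ _ hY)
      simpa [h3] using h2
    · intro X Y hX hY
      simp [hX, hY]
  · intro X Y hX hY
    exact add_mem hX hY

end Graded

/-! ### Jets of vector fields acting on a fibre -/

section Jets

variable {m n : ℕ}

/-- The exponent shift of the direction `D`, where `d_i` is replaced by `∂/∂t_i`. -/
def dsh : Dir m n true → LExp m
  | .di i => Pi.single i 1
  | .pa _ => 0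
  | .d0 => 0

/-- The parity of the direction `D`. -/
def dpar : Dir m n true → ℕ
  | .di _ => 0
  | .pa _ => 1
  | .d0 => 0

/-- The weight `1` of `∂/∂t_i` and `∂/∂ξ_α`, and the weight `0` of `d_0`. -/
def dwt : Dir m n true → ℕ
  | .di _ => 1
  | .pa _ => 1
  | .d0 => 0

/-- The scalar produced when `D` acts on the monomial `t^p ξ^r`. -/
noncomputable def dco : Dir m n true → LExp m → GExp n → ℂ
  | .di i, p, _ => p i
  | .pa a, _, r => derC a r
  | .d0, _, _ => 0

/-- The Grassmann exponent of `D (t^p ξ^r)`. -/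
def deG : Dir m n true → GExp n → GExp n
  | .di _, r => r
  | .pa a, r => derE a r
  | .d0, r => r

/-- The parity of `ξ^q D`. -/
def bpar (q : GExp n) (D : Dir m n true) : ℕ := gdeg q + dpar D

/-- The coefficient of `∂/∂ξ_α` in the direction `D`. -/
noncomputable def dod : Dir m n true → Fin n → ℂ
  | .di _, _ => 0
  | .pa a, b => if a = b then 1 else 0
  | .d0, _ => 0

lemma dsh_nonneg (D : Dir m n true) : 0 ≤ dsh D := by
  cases D <;> simp [dsh]

lemma sum_dsh_add_sum_dod (D : Dir m n true) :
    ∑ j, (dsh D j : ℂ) + ∑ a, dod D a = dwt D := by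
  cases D <;> simp [dsh, dod, dwt, Pi.single_apply]

lemma sub_dsh_nonneg {D : Dir m n true} {p : LExp m} {r : GExp n} (hp : 0 ≤ p)
    (h : dco D p r ≠ 0) : 0 ≤ p - dsh D := by
  cases D with
  | di i =>
    intro j
    have h1 := hp j
    simp only [Pi.zero_apply, Pi.sub_apply, dsh] at h1 ⊢
    by_cases hj : j = i
    · subst hj
      have : p j ≠ 0 := fun h0 => h (by simp [dco, h0])
      simp
      omega
    · simpa [hj] using h1
  | pa a => simpa [dsh] using hp
  | d0 => simpa [dsh] using hp

lemma gdeg_deG {D : Dir m n true} {p : LExp m} {r : GExp n} (h : dco D p r ≠ 0) :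
    gdeg (deG D r) + dpar D = gdeg r := by
  cases D with
  | di i => rfl
  | pa a =>
    refine gdeg_derE (n := n) ?_
    by_contra h0
    exact h (derC_of_false (by simpa using h0))
  | d0 => rfl

lemma neg_one_pow_mul_congr {x y a b : ℕ} (h1 : (-1 : ℂ) ^ x = (-1) ^ a)
    (h2 : (-1 : ℂ) ^ y = (-1) ^ b) : (-1 : ℂ) ^ (x * y) = (-1) ^ (a * b) := by
  rw [pow_mul, h1, ← pow_mul, mul_comm, pow_mul, h2, ← pow_mul, mul_comm]

variable {V : Type*} [AddCommGroup V] [Module ℂ V]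

/-- A family of operators `B s q D` on `V` that multiply like the vector fields
`(t^s ξ^q - δ) D̂` with `D̂ ∈ {∂/∂t_i, ∂/∂ξ_α, d_0}` vanishing at the point `t = 1, ξ = 0`. -/
structure IsJet (B : LExp m → GExp n → Dir m n true → Module.End ℂ V) : Prop where
  zero : ∀ D, B 0 gnil D = 0
  br : ∀ s q D p r D',
    B s q D * B p r D' - (-1 : ℂ) ^ (bpar q D * bpar r D') • (B p r D' * B s q D)
      = dco D p r • (mulSgn q (deG D r) • B (s + p - dsh D) (xorE q (deG D r)) D'
          - gaug q • B (p - dsh D) (deG D r) D')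
        - ((-1 : ℂ) ^ (bpar q D * bpar r D') * dco D' s q) •
          (mulSgn r (deG D' q) • B (p + s - dsh D') (xorE r (deG D' q)) D
            - gaug r • B (s - dsh D') (deG D' q) D)

/-- The linear part of a jet. -/
noncomputable def linPart (B : LExp m → GExp n → Dir m n true → Module.End ℂ V)
    (s : LExp m) (q : GExp n) (D : Dir m n true) : Module.End ℂ V :=
  gaug q • ∑ i, (s i : ℂ) • B (Pi.single i 1) gnil D
    + ∑ a, (if q = gone a then (1 : ℂ) else 0) • B 0 (gone a) D

/-- The span of the jets of parity `a` of the fields regular at `t = 0`. -/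
def regSpan (B : LExp m → GExp n → Dir m n true → Module.End ℂ V) (a : ℕ) :
    Submodule ℂ (Module.End ℂ V) :=
  Submodule.span ℂ {X | ∃ s q D, 0 ≤ s ∧ (-1 : ℂ) ^ bpar q D = (-1) ^ a ∧ X = B s q D}

/-- The jet of the Euler field. -/
noncomputable def eulerJet (B : LExp m → GExp n → Dir m n true → Module.End ℂ V) :
    Module.End ℂ V :=
  ∑ j, B (Pi.single j 1) gnil (.di j) + ∑ a, B 0 (gone a) (.pa a)

variable {B : LExp m → GExp n → Dir m n true → Module.End ℂ V}

lemma mem_regSpan {s : LExp m} (hs : 0 ≤ s) (q : GExp n) (D : Dir m n true) {a : ℕ}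
    (h : (-1 : ℂ) ^ bpar q D = (-1) ^ a) : B s q D ∈ regSpan B a :=
  Submodule.subset_span ⟨s, q, D, hs, h, rfl⟩

lemma IsJet.half_mem (s : LExp m) (q : GExp n) (D : Dir m n true) (p : LExp m)
    (r : GExp n) (D' : Dir m n true) (hs : 0 ≤ s) (hp : 0 ≤ p) {a : ℕ}
    (ha : (-1 : ℂ) ^ (bpar q D + bpar r D') = (-1) ^ a) :
    dco D p r • (mulSgn q (deG D r) • B (s + p - dsh D) (xorE q (deG D r)) D'
          - gaug q • B (p - dsh D) (deG D r) D') ∈ regSpan B a := by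
  by_cases h : dco D p r = 0
  · simp [h]
  have hd := gdeg_deG h
  have hn := sub_dsh_nonneg hp h
  refine Submodule.smul_mem _ _ (Submodule.sub_mem _ (Submodule.smul_mem _ _ ?_) ?_)
  · refine mem_regSpan (by rw [add_sub_assoc]; exact add_nonneg hs hn) _ _ ?_
    rw [← ha, bpar, bpar, bpar, ← hd, pow_add, neg_one_pow_gdeg_xorE]
    have : (-1 : ℂ) ^ dpar D * (-1) ^ dpar D = 1 := by simp [← mul_pow]
    simp only [pow_add]
    linear_combination (-(-1 : ℂ) ^ gdeg q * (-1) ^ gdeg (deG D r) * (-1) ^ dpar D') * this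
  · by_cases hq : q = gnil
    · subst hq
      refine Submodule.smul_mem _ _ (mem_regSpan hn _ _ ?_)
      rw [← ha, bpar, bpar, bpar, ← hd]
      have : (-1 : ℂ) ^ dpar D * (-1) ^ dpar D = 1 := by simp [← mul_pow]
      simp only [pow_add, gdeg_gnil, pow_zero]
      linear_combination (-(-1 : ℂ) ^ gdeg (deG D r) * (-1) ^ dpar D') * this
    · simp [gaug_of_ne hq]

lemma IsJet.superBracket_mem (hB : IsJet B) (a b : ℕ) {X Y : Module.End ℂ V}
    (hX : X ∈ regSpan B a) (hY : Y ∈ regSpan B b) :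
    X * Y - (-1 : ℂ) ^ (a * b) • (Y * X) ∈ regSpan B (a + b) := by
  induction hX using Submodule.span_induction with
  | zero => simp
  | add X X' _ _ h h' =>
    have : (X + X') * Y - (-1 : ℂ) ^ (a * b) • (Y * (X + X'))
      = (X * Y - (-1 : ℂ) ^ (a * b) • (Y * X)) + (X' * Y - (-1 : ℂ) ^ (a * b) • (Y * X')) := by
      rw [add_mul, mul_add, smul_add]; abel
    rw [this]; exact add_mem h h'
  | smul c X _ h =>
    have : (c • X) * Y - (-1 : ℂ) ^ (a * b) • (Y * (c • X))
      = c • (X * Y - (-1 : ℂ) ^ (a * b) • (Y * X)) := by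
      rw [smul_mul_assoc, mul_smul_comm, smul_sub, smul_comm c]
    rw [this]; exact Submodule.smul_mem _ _ h
  | mem X hX =>
    obtain ⟨s, q, D, hs, hq, rfl⟩ := hX
    induction hY using Submodule.span_induction with
    | zero => simp
    | add X X' _ _ h h' =>
      have : B s q D * (X + X') - (-1 : ℂ) ^ (a * b) • ((X + X') * B s q D)
        = (B s q D * X - (-1 : ℂ) ^ (a * b) • (X * B s q D))
          + (B s q D * X' - (-1 : ℂ) ^ (a * b) • (X' * B s q D)) := by
        rw [add_mul, mul_add, smul_add]; abel
      rw [this]; exact add_mem h h'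
    | smul c X _ h =>
      have : B s q D * (c • X) - (-1 : ℂ) ^ (a * b) • ((c • X) * B s q D)
        = c • (B s q D * X - (-1 : ℂ) ^ (a * b) • (X * B s q D)) := by
        rw [smul_mul_assoc, mul_smul_comm, smul_sub, smul_comm c]
      rw [this]; exact Submodule.smul_mem _ _ h
    | mem Y hY =>
      obtain ⟨p, r, D', hp, hr, rfl⟩ := hY
      rw [← neg_one_pow_mul_congr hq hr, hB.br, mul_smul]
      have h1 : (-1 : ℂ) ^ (bpar q D + bpar r D') = (-1) ^ (a + b) := by
        rw [pow_add, pow_add, hq, hr]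
      exact Submodule.sub_mem _ (IsJet.half_mem s q D p r D' hs hp h1)
        (Submodule.smul_mem _ _
          (IsJet.half_mem p r D' s q D hp hs (by rw [add_comm]; exact h1)))

lemma IsJet.commutator_di (hB : IsJet B) (j : Fin m) (p : LExp m) (r : GExp n)
    (D : Dir m n true) :
    B (Pi.single j 1) gnil (.di j) * B p r D - B p r D * B (Pi.single j 1) gnil (.di j)
      = (p j : ℂ) • (B p r D - B (p - Pi.single j 1) r D) - (dsh D j : ℂ) • B p r D := by
  have h := hB.br (Pi.single j 1) gnil (.di j) p r D
  have h0 : bpar (gnil : GExp n) (.di j : Dir m n true) = 0 := by simp [bpar, dpar]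
  have e1 : Pi.single j 1 + p - dsh (.di j : Dir m n true) = p := by simp [dsh]
  rw [h0, zero_mul, pow_zero, one_smul, one_mul, e1] at h
  rw [h]
  simp only [dco, deG, gnil_mulSgn, gnil_xorE, gaug_gnil, one_smul]
  congr 1
  cases D with
  | di i =>
    by_cases hij : i = j
    · subst hij
      simp [dsh, hB.zero]
    · simp [dsh, hij, Ne.symm hij]
  | pa a => simp [dsh]
  | d0 => simp [dsh]

lemma IsJet.commutator_pa (hB : IsJet B) (a : Fin n) (p : LExp m) (r : GExp n)
    (D : Dir m n true) :
    B 0 (gone a) (.pa a) * B p r D - B p r D * B 0 (gone a) (.pa a)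
      = (if r a = true then (1 : ℂ) else 0) • B p r D - dod D a • B p r D := by
  have h := hB.br 0 (gone a) (.pa a) p r D
  have h0 : bpar (gone a : GExp n) (.pa a : Dir m n true) = 2 := by simp [bpar, dpar]
  rw [h0, pow_mul] at h
  simp only [even_two, Even.neg_pow, one_pow, one_smul, one_mul] at h
  rw [h, gaug_of_ne (gone_ne_gnil a)]
  congr 1
  · simp only [dco, deG, dsh, zero_add, sub_zero, zero_smul]
    split_ifs with hr
    · rw [smul_smul, derC_mul_mulSgn hr, xorE_gone_derE hr]
    · rw [derC_of_false (by simpa using hr)]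
      simp
  · cases D with
    | di i => simp [dco, dod]
    | pa b =>
      by_cases hb : b = a
      · subst hb
        simp [dco, dod, dsh, deG, hB.zero]
      · simp [dco, dod, hb, derC_gone_of_ne hb]
    | d0 => simp [dco, dod]

lemma IsJet.commutator_euler (hB : IsJet B) (p : LExp m) (r : GExp n) (D : Dir m n true) :
    eulerJet B * B p r D - B p r D * eulerJet B
      = ((∑ j, (p j : ℂ)) + gdeg r - dwt D) • B p r D
        - ∑ j, (p j : ℂ) • B (p - Pi.single j 1) r D := by
  have e : eulerJet B * B p r D - B p r D * eulerJet B
      = ∑ j, (B (Pi.single j 1) gnil (.di j) * B p r D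
          - B p r D * B (Pi.single j 1) gnil (.di j))
        + ∑ a, (B 0 (gone a) (.pa a) * B p r D - B p r D * B 0 (gone a) (.pa a)) := by
    rw [eulerJet, add_mul, mul_add, Finset.sum_mul, Finset.sum_mul, Finset.mul_sum,
      Finset.mul_sum, Finset.sum_sub_distrib, Finset.sum_sub_distrib]
    abel
  have hg : (∑ a, if r a = true then (1 : ℂ) else 0) = gdeg r := by
    simp [gdeg]
  rw [e, ← sum_dsh_add_sum_dod, ← hg]
  simp only [hB.commutator_di, hB.commutator_pa, Finset.sum_sub_distrib, smul_sub,
    ← Finset.sum_smul, sub_smul, add_smul]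
  abel

end Jets

section Jets

variable {m n : ℕ} {V : Type*} [AddCommGroup V] [Module ℂ V]
  {B : LExp m → GExp n → Dir m n true → Module.End ℂ V}

lemma sub_single_nonneg {p : LExp m} (hp : 0 ≤ p) {j : Fin m} (hj : p j ≠ 0) :
    0 ≤ p - Pi.single j 1 := by
  intro i
  have h1 := hp i
  simp only [Pi.zero_apply, Pi.sub_apply] at h1 ⊢
  by_cases h : i = j
  · subst h
    simp
    omega
  · simpa [h] using h1

lemma sum_sub_single (p : LExp m) (j : Fin m) :
    ∑ i, (p - Pi.single j 1 : LExp m) i = ∑ i, p i - 1 := by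
  simp [Finset.sum_sub_distrib]

lemma eq_zero_of_sum_eq_zero {p : LExp m} (hp : 0 ≤ p) (h : ∑ i, p i = 0) : p = 0 := by
  funext i
  exact (Finset.sum_eq_zero_iff_of_nonneg fun i _ => hp i).mp h i (Finset.mem_univ i)

lemma eq_single_of_sum_eq_one {p : LExp m} (hp : 0 ≤ p) (h : ∑ i, p i = 1) :
    ∃ j, p = Pi.single j 1 := by
  have : ∃ j, p j ≠ 0 := by
    by_contra hc
    push Not at hc
    simp [hc] at h
  obtain ⟨j, hj⟩ := this
  refine ⟨j, sub_eq_zero.mp (eq_zero_of_sum_eq_zero (sub_single_nonneg hp hj) ?_)⟩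
  rw [sum_sub_single, h, sub_self]

lemma IsJet.mem_iSup_gradedPart (hB : IsJet B) (t : ℕ) : ∀ (p : LExp m) (r : GExp n)
    (D : Dir m n true) (a : ℕ), 0 ≤ p → ∑ j, p j + gdeg r = t →
    (-1 : ℂ) ^ bpar r D = (-1) ^ a →
    B p r D ∈ ⨆ c : Fin (t + 1 - dwt D), gradedPart (eulerJet B) (regSpan B a) c := by
  induction t with
  | zero =>
    intro p r D a hp ht ha
    have hs : 0 ≤ ∑ j, p j := Finset.sum_nonneg fun j _ => hp j
    have h1 : p = 0 := eq_zero_of_sum_eq_zero hp (by push_cast at ht; omega)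
    have h2 : r = gnil := gdeg_eq_zero_iff.mp (by push_cast at ht; omega)
    rw [h1, h2, hB.zero]
    exact zero_mem _
  | succ t ih =>
    intro p r D a hp ht ha
    have hw : dwt D ≤ t + 1 := by cases D <;> simp [dwt]
    have hk : t + 1 + 1 - dwt D = (t + 1 - dwt D) + 1 := by omega
    rw [hk]
    refine mem_iSup_gradedPart_of_commutator (mem_regSpan hp _ _ ha) ?_
    rw [hB.commutator_euler]
    have hc : ((∑ j, (p j : ℂ)) + gdeg r - dwt D) = ((t + 1 - dwt D : ℕ) : ℂ) := by
      rw [Nat.cast_sub hw]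
      congr 1
      exact_mod_cast ht
    rw [hc, sub_right_comm, sub_self, zero_sub]
    refine neg_mem (Submodule.sum_mem _ fun j _ => ?_)
    by_cases hj : p j = 0
    · simp [hj]
    refine Submodule.smul_mem _ _ (ih _ r D a (sub_single_nonneg hp hj) ?_ ha)
    rw [sum_sub_single]
    push_cast at ht
    omega

lemma IsJet.regSpan_le (hB : IsJet B) (a : ℕ) :
    regSpan B a ≤ ⨆ c : ℕ, gradedPart (eulerJet B) (regSpan B a) c := by
  refine Submodule.span_le.mpr ?_
  rintro _ ⟨p, r, D, hp, ha, rfl⟩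
  have hs : 0 ≤ ∑ j, p j := Finset.sum_nonneg fun j _ => hp j
  obtain ⟨t, ht⟩ := Int.eq_ofNat_of_zero_le (add_nonneg hs (Int.natCast_nonneg (gdeg r)))
  have h := hB.mem_iSup_gradedPart t p r D a hp ht ha
  exact (iSup_le fun c : Fin (t + 1 - dwt D) =>
    le_iSup (fun c : ℕ => gradedPart (eulerJet B) (regSpan B a) c) (c : ℕ)) h

/-- The elements of positive degree. -/
noncomputable abbrev posSpan (B : LExp m → GExp n → Dir m n true → Module.End ℂ V) (a : ℕ) :
    Submodule ℂ (Module.End ℂ V) :=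
  positivePart (eulerJet B) (regSpan B a)

lemma IsJet.commutator_mem (hB : IsJet B) {p : LExp m} (hp : 0 ≤ p) (r : GExp n)
    (D : Dir m n true) {a : ℕ} (ha : (-1 : ℂ) ^ bpar r D = (-1) ^ a) :
    ((∑ j, (p j : ℂ)) + gdeg r - dwt D) • B p r D
        - ∑ j, (p j : ℂ) • B (p - Pi.single j 1) r D ∈ posSpan B a := by
  rw [← hB.commutator_euler]
  exact commutator_mem_positivePart (hB.regSpan_le a) (mem_regSpan hp _ _ ha)

lemma IsJet.single_d0_mem (hB : IsJet B) (i : Fin m) :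
    B (Pi.single i 1) gnil .d0 ∈ posSpan B 0 := by
  have h := hB.commutator_mem (p := Pi.single i 1) (Pi.single_nonneg.mpr zero_le_one) gnil .d0
    (a := 0) (by simp [bpar, dpar])
  have e : ∑ j, ((Pi.single i 1 : LExp m) j : ℂ) • B (Pi.single i 1 - Pi.single j 1) gnil .d0
      = 0 := by
    refine Finset.sum_eq_zero fun j _ => ?_
    by_cases hj : j = i
    · subst hj
      simp [hB.zero]
    · simp [hj]
  rw [e] at h
  have e2 : ∑ j, ((Pi.single i 1 : LExp m) j : ℂ) = 1 := by
    simp [Pi.single_apply]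
  simpa [e2, dwt] using h

lemma IsJet.gone_d0_mem (hB : IsJet B) (b : Fin n) :
    B 0 (gone b) .d0 ∈ posSpan B 1 := by
  have h := hB.commutator_mem (p := 0) le_rfl (gone b) .d0
    (a := 1) (by simp [bpar, dpar])
  simpa [dwt] using h

lemma linPart_gnil (B : LExp m → GExp n → Dir m n true → Module.End ℂ V) (s : LExp m)
    (D : Dir m n true) :
    linPart B s gnil D = ∑ i, (s i : ℂ) • B (Pi.single i 1) gnil D := by
  simp [linPart, (gone_ne_gnil _).symm]

lemma linPart_gone (B : LExp m → GExp n → Dir m n true → Module.End ℂ V) (s : LExp m)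
    (b : Fin n) (D : Dir m n true) : linPart B s (gone b) D = B 0 (gone b) D := by
  simp [linPart, gaug_of_ne (gone_ne_gnil b), gone_injective.eq_iff]

lemma linPart_of_two_le (B : LExp m → GExp n → Dir m n true → Module.End ℂ V) (s : LExp m)
    {q : GExp n} (hq : 2 ≤ gdeg q) (D : Dir m n true) : linPart B s q D = 0 := by
  have h1 : q ≠ gnil := fun h => by simp [h] at hq
  have h2 : ∀ a, q ≠ gone a := fun a h => by simp [h] at hq
  simp [linPart, gaug_of_ne h1, h2]

lemma gexp_cases (q : GExp n) : q = gnil ∨ (∃ a, q = gone a) ∨ 2 ≤ gdeg q := by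
  rcases Nat.lt_or_ge (gdeg q) 2 with h | h
  · interval_cases hq : gdeg q
    · exact Or.inl (gdeg_eq_zero_iff.mp hq)
    · exact Or.inr (Or.inl (gdeg_eq_one_iff.mp hq))
  · exact Or.inr (Or.inr h)

lemma linPart_sub (s s' : LExp m) (q : GExp n) (D : Dir m n true) :
    linPart B (s - s') q D = linPart B s q D
      - gaug q • ∑ i, (s' i : ℂ) • B (Pi.single i 1) gnil D := by
  simp only [linPart, Pi.sub_apply, Int.cast_sub, sub_smul, Finset.sum_sub_distrib, smul_sub]
  abel

lemma sum_linPart_sub_single (s : LExp m) (q : GExp n) (D : Dir m n true) :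
    ∑ j, (s j : ℂ) • linPart B (s - Pi.single j 1) q D
      = ((∑ j, (s j : ℂ)) + gdeg q - 1) • linPart B s q D := by
  rcases gexp_cases q with rfl | ⟨b, rfl⟩ | hq
  · have : ∀ j : Fin m, ∑ i, ((Pi.single j 1 : LExp m) i : ℂ) • B (Pi.single i 1) gnil D
        = B (Pi.single j 1) gnil D := by
      intro j
      rw [Finset.sum_eq_single j] <;> simp +contextual
    simp only [linPart_sub, this, gaug_gnil, one_smul, smul_sub, Finset.sum_sub_distrib,
      ← Finset.sum_smul, sub_smul, add_smul, gdeg_gnil]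
    simp [linPart_gnil]
  · simp only [linPart_gone, ← Finset.sum_smul, gdeg_gone]
    simp
  · simp [linPart_of_two_le B _ hq]

lemma IsJet.linPart_mem (s : LExp m) (q : GExp n) (D : Dir m n true) {a : ℕ}
    (ha : (-1 : ℂ) ^ bpar q D = (-1) ^ a) : linPart B s q D ∈ regSpan B a := by
  rcases gexp_cases q with rfl | ⟨b, rfl⟩ | hq
  · rw [linPart_gnil]
    exact Submodule.sum_mem _ fun i _ => Submodule.smul_mem _ _
      (mem_regSpan (Pi.single_nonneg.mpr zero_le_one) _ _ ha)
  · rw [linPart_gone]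
    exact mem_regSpan le_rfl _ _ ha
  · rw [linPart_of_two_le B _ hq]
    exact zero_mem _

lemma IsJet.linPart_d0_mem (hB : IsJet B) (s : LExp m) (q : GExp n) :
    linPart B s q .d0 ∈ posSpan B (gdeg q) := by
  rcases gexp_cases q with rfl | ⟨b, rfl⟩ | hq
  · rw [linPart_gnil, gdeg_gnil]
    exact Submodule.sum_mem _ fun i _ => Submodule.smul_mem _ _ (hB.single_d0_mem i)
  · rw [linPart_gone, gdeg_gone]
    exact hB.gone_d0_mem b
  · rw [linPart_of_two_le B _ hq]
    exact zero_mem _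

lemma IsJet.linPart_single (s : LExp m) (hs : ∃ j, s = Pi.single j 1) (D : Dir m n true) :
    linPart B s gnil D = B s gnil D := by
  obtain ⟨j, rfl⟩ := hs
  rw [linPart_gnil, Finset.sum_eq_single j] <;> simp +contextual

lemma IsJet.sub_linPart_mem (hB : IsJet B) (t : ℕ) : ∀ (p : LExp m) (r : GExp n)
    (D : Dir m n true), 0 ≤ p → ∑ j, p j + gdeg r = t →
    B p r D - linPart B p r D ∈ posSpan B (bpar r D) := by
  have base : ∀ (D : Dir m n true), B 0 gnil D - linPart B 0 gnil D ∈ posSpan B (bpar gnil D) := by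
    intro D
    simp [hB.zero, linPart_gnil]
  induction t with
  | zero =>
    intro p r D hp ht
    have hs : 0 ≤ ∑ j, p j := Finset.sum_nonneg fun j _ => hp j
    have h1 : p = 0 := eq_zero_of_sum_eq_zero hp (by push_cast at ht; omega)
    have h2 : r = gnil := gdeg_eq_zero_iff.mp (by push_cast at ht; omega)
    rw [h1, h2]
    exact base D
  | succ t ih =>
    intro p r D hp ht
    have hs : 0 ≤ ∑ j, p j := Finset.sum_nonneg fun j _ => hp j
    have hsum : (∑ j, (p j : ℂ)) + gdeg r = t + 1 := by exact_mod_cast ht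
    have h1 := hB.commutator_mem hp r D rfl
    have h2 : ∑ j, (p j : ℂ) • (B (p - Pi.single j 1) r D - linPart B (p - Pi.single j 1) r D)
        ∈ posSpan B (bpar r D) := by
      refine Submodule.sum_mem _ fun j _ => ?_
      by_cases hj : p j = 0
      · simp [hj]
      refine Submodule.smul_mem _ _ (ih _ r D (sub_single_nonneg hp hj) ?_)
      rw [sum_sub_single]
      push_cast at ht
      omega
    have h3 := add_mem h1 h2
    simp only [smul_sub, Finset.sum_sub_distrib, sum_linPart_sub_single, hsum] at h3
    have key : ((t : ℂ) + 1 - dwt D) • (B p r D - linPart B p r D)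
        + ((1 : ℂ) - dwt D) • linPart B p r D ∈ posSpan B (bpar r D) := by
      convert h3 using 1
      module
    have h4 : ((1 : ℂ) - dwt D) • linPart B p r D ∈ posSpan B (bpar r D) := by
      cases D with
      | di i => simp [dwt]
      | pa i => simp [dwt]
      | d0 => exact Submodule.smul_mem _ _ (hB.linPart_d0_mem p r)
    have h5 := (Submodule.add_mem_iff_left _ h4).mp key
    by_cases hz : ((t : ℂ) + 1 - dwt D) = 0
    · have hz' : t + 1 = dwt D := by
        have := sub_eq_zero.mp hz
        exact_mod_cast this
      have ht0 : t = 0 := by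
        have : dwt D ≤ 1 := by cases D <;> simp [dwt]
        omega
      subst ht0
      push_cast at ht
      rcases gexp_cases r with rfl | ⟨b, rfl⟩ | hq
      · rw [IsJet.linPart_single p (eq_single_of_sum_eq_one hp (by simpa using ht)), sub_self]
        exact zero_mem _
      · have : p = 0 := eq_zero_of_sum_eq_zero hp (by simpa using ht)
        rw [linPart_gone, this, sub_self]
        exact zero_mem _
      · omega
    · exact (Submodule.smul_mem_iff _ hz).mp h5

/-- The vectors killed by the elements of positive degree. -/
noncomputable def jetInvariants (B : LExp m → GExp n → Dir m n true → Module.End ℂ V) :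
    Submodule ℂ V :=
  positiveInvariants (eulerJet B) (regSpan B)

variable {v : V}

lemma IsJet.regular_apply_mem (hB : IsJet B) {a : ℕ} {Z : Module.End ℂ V}
    (hZ : Z ∈ regSpan B a) (hv : v ∈ jetInvariants B) : Z v ∈ jetInvariants B :=
  apply_mem_positiveInvariants hB.regSpan_le
    (fun a b _ hX _ hY => hB.superBracket_mem a b hX hY) hZ hv

lemma IsJet.regular_apply (hB : IsJet B) (hv : v ∈ jetInvariants B) {p : LExp m} (hp : 0 ≤ p)
    (r : GExp n) (D : Dir m n true) : B p r D v = linPart B p r D v := by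
  have hs : 0 ≤ ∑ j, p j := Finset.sum_nonneg fun j _ => hp j
  obtain ⟨t, ht⟩ := Int.eq_ofNat_of_zero_le (add_nonneg hs (Int.natCast_nonneg (gdeg r)))
  have h := mem_positiveInvariants.mp hv _ _ (hB.sub_linPart_mem t p r D hp ht)
  rwa [LinearMap.sub_apply, sub_eq_zero] at h

end Jets

section Jets

variable {m n : ℕ} {V : Type*} [AddCommGroup V] [Module ℂ V]
  {B : LExp m → GExp n → Dir m n true → Module.End ℂ V}

lemma linPart_add (s s' : LExp m) (q : GExp n) (D : Dir m n true) :
    linPart B (s + s') q D = linPart B s q D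
      + gaug q • ∑ i, (s' i : ℂ) • B (Pi.single i 1) gnil D := by
  simp only [linPart, Pi.add_apply, Int.cast_add, add_smul, Finset.sum_add_distrib, smul_add]
  abel

lemma linPart_add_sub (s s' : LExp m) (q : GExp n) (D : Dir m n true) :
    linPart B (s + s') q D - gaug q • linPart B s' gnil D = linPart B s q D := by
  rw [linPart_add, linPart_gnil]
  abel

lemma IsJet.commutator_gnil_di (hB : IsJet B) (s : LExp m) (q : GExp n) (D : Dir m n true)
    (p : LExp m) (j : Fin m) :
    B s q D * B (p + Pi.single j 1) gnil (.di j) - B (p + Pi.single j 1) gnil (.di j) * B s q D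
      = dco D (p + Pi.single j 1) gnil •
          (B (s + (p + Pi.single j 1 - dsh D)) q (.di j)
            - gaug q • B (p + Pi.single j 1 - dsh D) gnil (.di j))
        - (s j : ℂ) • (B (s + p) q D - B (s - Pi.single j 1) q D) := by
  have h := hB.br s q D (p + Pi.single j 1) gnil (.di j)
  have h0 : bpar (gnil : GExp n) (.di j : Dir m n true) = 0 := by simp [bpar, dpar]
  have e1 : p + Pi.single j 1 + s - Pi.single j 1 = s + p := by abel
  rw [h0, mul_zero, pow_zero, one_smul, one_mul] at h
  rw [h]
  congr 1
  · cases D with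
    | di i => simp [deG, dsh, add_sub_assoc]
    | pa a => simp [dco]
    | d0 => simp [dco]
  · simp [dco, deG, dsh, e1]

variable {v : V}

/-- A second difference of the jets of `∂/∂t_j` has positive degree. -/
lemma IsJet.secondDifference_mem (hB : IsJet B) (k : ℕ) (j : Fin m) :
    B ((fun _ => 2 * (k : ℤ)) + Pi.single j 1) gnil (.di j)
      - (2 : ℂ) • B ((fun _ => (k : ℤ)) + Pi.single j 1) gnil (.di j)
      + B (0 + Pi.single j 1) gnil (.di j) ∈ posSpan B 0 := by
  have hb : bpar (gnil : GExp n) (.di j : Dir m n true) = 0 := by simp [bpar, dpar]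
  have key : ∀ c : ℕ, B ((fun _ => (c : ℤ)) + Pi.single j 1) gnil (.di j)
      - linPart B ((fun _ => (c : ℤ)) + Pi.single j 1) gnil (.di j) ∈ posSpan B 0 := by
    intro c
    have hp : (0 : LExp m) ≤ (fun _ => (c : ℤ)) + Pi.single j 1 :=
      add_nonneg (fun _ => Int.natCast_nonneg c) (Pi.single_nonneg.mpr zero_le_one)
    have hs := Finset.sum_nonneg (s := Finset.univ) fun i _ => hp i
    obtain ⟨t, ht⟩ := Int.eq_ofNat_of_zero_le (add_nonneg hs (Int.natCast_nonneg
      (gdeg (gnil : GExp n))))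
    have := hB.sub_linPart_mem t _ gnil (.di j) hp ht
    rwa [hb] at this
  have h0 := key 0
  have h1 := key k
  have h2 := key (2 * k)
  have h := add_mem (sub_mem h2 (Submodule.smul_mem _ (2 : ℂ) h1)) h0
  have z : (fun _ => ((0 : ℕ) : ℤ)) = (0 : LExp m) := by funext; simp
  have e2 : (fun _ => ((2 * k : ℕ) : ℤ)) = (fun _ => 2 * (k : ℤ) : LExp m) := by funext; simp
  rw [z, e2] at h
  convert h using 1
  rw [add_comm _ (Pi.single j 1), add_comm _ (Pi.single j 1), add_comm (0 : LExp m)]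
  simp only [linPart_add (Pi.single j 1), gaug_gnil, one_smul]
  simp only [Pi.zero_apply, Int.cast_zero, zero_smul, Finset.sum_const_zero, ← Finset.smul_sum]
  push_cast
  module

lemma IsJet.linPart_apply_mem (hB : IsJet B) (hv : v ∈ jetInvariants B) (s : LExp m)
    (q : GExp n) (D : Dir m n true) : linPart B s q D v ∈ jetInvariants B :=
  hB.regular_apply_mem (IsJet.linPart_mem s q D rfl) hv

lemma IsJet.jet_apply [FiniteDimensional ℂ V] (hB : IsJet B) (hv : v ∈ jetInvariants B)
    (s : LExp m) (q : GExp n) (D : Dir m n true) : B s q D v = linPart B s q D v := by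
  by_cases hs : ∀ j, s j = dsh D j
  · have : s = dsh D := funext hs
    exact hB.regular_apply hv (this ▸ dsh_nonneg D) q D
  push Not at hs
  obtain ⟨j, hj⟩ := hs
  obtain ⟨k, hk1, hk⟩ : ∃ k : ℕ, 1 ≤ k ∧ ∀ i, 1 ≤ k + s i := by
    refine ⟨1 + ∑ i, (s i).natAbs, by omega, fun i => ?_⟩
    have := Finset.single_le_sum (f := fun i => (s i).natAbs) (fun _ _ => Nat.zero_le _)
      (Finset.mem_univ i)
    omega
  set Y := B ((fun _ => 2 * (k : ℤ)) + Pi.single j 1) gnil (.di j)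
      - (2 : ℂ) • B ((fun _ => (k : ℤ)) + Pi.single j 1) gnil (.di j)
      + B (0 + Pi.single j 1) gnil (.di j) with hY
  have hYP : Y ∈ posSpan B 0 := hB.secondDifference_mem k j
  have hYL : Y (linPart B s q D v) = 0 :=
    mem_positiveInvariants.mp (hB.linPart_apply_mem hv s q D) _ _ hYP
  have hYv : Y v = 0 := mem_positiveInvariants.mp hv _ _ hYP
  have hd : ∀ i, dsh D i ≤ 1 := by
    intro l
    cases D with
    | di i => by_cases h : l = i <;> simp [dsh, h]
    | pa a => simp [dsh]
    | d0 => simp [dsh]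
  set U := (gaug q • ∑ i, B (Pi.single i 1) gnil D) v with hU
  set X := linPart B s q (.di j) v with hX
  have big : ∀ c : ℕ, 1 ≤ c → (∀ i, 1 ≤ c + s i) →
      B s q D (B ((fun _ => (c : ℤ)) + Pi.single j 1) gnil (.di j) v)
        - B ((fun _ => (c : ℤ)) + Pi.single j 1) gnil (.di j) (B s q D v)
      = dco D ((fun _ => (c : ℤ)) + Pi.single j 1) gnil • X
        - (s j : ℂ) • (linPart B s q D v + (c : ℂ) • U - B (s - Pi.single j 1) q D v) := by
    intro c hc1 hc
    have h := congrArg (fun T : Module.End ℂ V => T v)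
      (hB.commutator_gnil_di s q D (fun _ => (c : ℤ)) j)
    simp only [LinearMap.sub_apply, LinearMap.smul_apply, Module.End.mul_apply] at h
    have n1 : 0 ≤ (fun _ => (c : ℤ)) + Pi.single j 1 - dsh D := by
      intro i
      have h1 := hd i
      have h2 : (0 : ℤ) ≤ (Pi.single j 1 : LExp m) i :=
        (Pi.single_nonneg (i := j).mpr zero_le_one : (0 : LExp m) ≤ Pi.single j 1) i
      simp only [Pi.zero_apply, Pi.sub_apply, Pi.add_apply]
      omega
    have n2 : 0 ≤ s + ((fun _ => (c : ℤ)) + Pi.single j 1 - dsh D) := by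
      intro i
      have h1 := hd i
      have h2 : (0 : ℤ) ≤ (Pi.single j 1 : LExp m) i :=
        (Pi.single_nonneg (i := j).mpr zero_le_one : (0 : LExp m) ≤ Pi.single j 1) i
      have h3 := hc i
      simp only [Pi.zero_apply, Pi.sub_apply, Pi.add_apply]
      omega
    have n3 : 0 ≤ s + (fun _ => (c : ℤ)) := by
      intro i
      have h3 := hc i
      simp only [Pi.zero_apply, Pi.add_apply]
      omega
    rw [h, hB.regular_apply hv n1, hB.regular_apply hv n2, hB.regular_apply hv n3,
      ← LinearMap.smul_apply, ← LinearMap.sub_apply, linPart_add_sub, linPart_add s]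
    simp only [hU, LinearMap.add_apply, LinearMap.smul_apply, ← Finset.smul_sum, Int.cast_natCast]
    rw [smul_comm (gaug q)]
  have small : B s q D (B (0 + Pi.single j 1) gnil (.di j) v)
        - B (0 + Pi.single j 1) gnil (.di j) (B s q D v)
      = (dsh D j : ℂ) • B s q D v
        - (s j : ℂ) • (B s q D v - B (s - Pi.single j 1) q D v) := by
    have h := congrArg (fun T : Module.End ℂ V => T v) (hB.commutator_gnil_di s q D 0 j)
    simp only [LinearMap.sub_apply, LinearMap.smul_apply, Module.End.mul_apply] at h
    rw [h, add_zero]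
    congr 1
    cases D with
    | di i =>
      by_cases hij : i = j
      · subst hij
        simp [dsh, dco, hB.zero]
      · simp [dsh, dco, hij, Ne.symm hij]
    | pa a => simp [dco, dsh]
    | d0 => simp [dco, dsh]
  have c1 : dco D ((fun _ => ((2 * k : ℕ) : ℤ)) + Pi.single j 1) (gnil : GExp n) • X
      - (2 : ℂ) • dco D ((fun _ => (k : ℤ)) + Pi.single j 1) (gnil : GExp n) • X
      = -((dsh D j : ℂ) • linPart B s q D v) := by
    cases D with
    | di i =>
      by_cases hij : i = j
      · subst hij
        simp [dsh, dco, hX]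
        module
      · simp [dsh, dco, hij, Ne.symm hij]
        module
    | pa a => simp [dco, dsh]
    | d0 => simp [dco, dsh]
  have key : Y (B s q D v - linPart B s q D v)
      = ((s j : ℂ) - dsh D j) • (B s q D v - linPart B s q D v) := by
    have b1 := big k hk1 hk
    have b2 := big (2 * k) (by omega) (fun i => by have := hk i; push_cast; omega)
    have e2 : (fun _ => ((2 * k : ℕ) : ℤ)) = (fun _ => 2 * (k : ℤ) : LExp m) := by
      funext; simp
    have hYB : B s q D (Y v) - Y (B s q D v)
        = (dsh D j - s j : ℂ) • (B s q D v - linPart B s q D v) := by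
      simp only [hY, LinearMap.add_apply, LinearMap.sub_apply, LinearMap.smul_apply, map_add,
        map_sub, map_smul]
      rw [e2] at b2 c1
      have h1 := congrArg₂ (· + ·) (congrArg₂ (· - ·) b2 (congrArg ((2 : ℂ) • ·) b1)) small
      simp only at h1
      have h2 : ∀ a b a' b' a'' b'' : V, a - (2 : ℂ) • a' + a'' - (b - (2 : ℂ) • b' + b'')
        = a - b - (2 : ℂ) • (a' - b') + (a'' - b'') := by intros; module
      rw [h2, h1]
      have h3 : ∀ x y z z' w w' : V, x - z - (2 : ℂ) • (y - z') + (w - w')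
        = (x - (2 : ℂ) • y) + ((2 : ℂ) • z' - z + w - w') := by intros; module
      rw [h3, c1]
      push_cast
      module
    rw [hYv, map_zero, zero_sub] at hYB
    rw [map_sub, hYL, sub_zero, ← neg_neg (Y _), hYB, ← neg_smul, neg_sub]
  exact sub_eq_zero.mp (eq_zero_of_positivePart_eigenvector hYP
    (by rw [sub_ne_zero]; exact_mod_cast hj) key)

end Jets

/-! ### The operators of an `AV`-module -/

section Operators

variable {m n : ℕ} (ρ : AVRep m n true)

/-- The action of `t^s ξ^q D`. -/
noncomputable def gOp (s : LExp m) (q : GExp n) (D : Dir m n true) : Module.End ℂ ρ.M :=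
  ρ.act (sng (s, q, D))

/-- Multiplication by `t^s ξ^q`. -/
noncomputable def aOp (s : LExp m) (q : GExp n) : Module.End ℂ ρ.M :=
  ρ.aact (asng (s, q))

/-- The action of `t^s ξ^q D̂` with `D̂ ∈ {∂/∂t_i, ∂/∂ξ_α, d_0}`. -/
noncomputable def wOp (s : LExp m) (q : GExp n) (D : Dir m n true) : Module.End ℂ ρ.M :=
  gOp ρ (s - dsh D) q D

/-- The action of `(t^s ξ^q - δ) D̂`, where `δ` is the value of `t^s ξ^q` at `t = 1, ξ = 0`. -/
noncomputable def oOp (s : LExp m) (q : GExp n) (D : Dir m n true) : Module.End ℂ ρ.M :=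
  wOp ρ s q D - gaug q • wOp ρ 0 gnil D

lemma neg_one_pow_par (s : LExp m) (q : GExp n) (D : Dir m n true) :
    (-1 : ℂ) ^ par (s, q, D) = (-1) ^ bpar q D := by
  cases D <;> exact (neg_one_pow_eq_pow_mod_two _).symm

lemma neg_one_pow_apar (s : LExp m) (q : GExp n) :
    (-1 : ℂ) ^ apar (s, q) = (-1) ^ gdeg q :=
  (neg_one_pow_eq_pow_mod_two _).symm

lemma aOp_zero_gnil : aOp ρ 0 gnil = 1 := ρ.aact_one

lemma aOp_mul (s p : LExp m) (q r : GExp n) :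
    aOp ρ s q * aOp ρ p r = mulSgn q r • aOp ρ (s + p) (xorE q r) := by
  have h := ρ.aact_mul (s, q) (p, r)
  rw [amulB, map_smul] at h
  exact h.symm

lemma gOp_bracket (s : LExp m) (q : GExp n) (D : Dir m n true) (p : LExp m) (r : GExp n)
    (D' : Dir m n true) :
    gOp ρ s q D * gOp ρ p r D' - (-1 : ℂ) ^ (bpar q D * bpar r D') • (gOp ρ p r D' * gOp ρ s q D)
      = (dco D p r * mulSgn q (deG D r)) • gOp ρ (s + p) (xorE q (deG D r)) D'
        - ((-1 : ℂ) ^ (bpar q D * bpar r D') * dco D' s q * mulSgn r (deG D' q)) •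
          gOp ρ (s + p) (xorE r (deG D' q)) D := by
  have h := ρ.super (s, q, D) (p, r, D')
  rw [neg_one_pow_mul_congr (neg_one_pow_par s q D) (neg_one_pow_par p r D')] at h
  refine Eq.trans h.symm ?_
  cases D with
  | di i =>
    cases D' with
    | di j =>
      simp only [brB, map_sub, map_smul, bpar, dpar, dco, deG, gOp, add_zero]
      congr 2
      · rw [mulSgn_swap q r]; ring
      · rw [xorE_comm]
    | pa b => simp only [brB, map_sub, map_smul, bpar, dpar, dco, deG, gOp, add_zero]
    | d0 => simp [brB, bpar, dpar, dco, deG, gOp]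
  | pa a =>
    cases D' with
    | di j => simp only [brB, map_sub, map_smul, bpar, dpar, dco, deG, gOp, add_zero]
    | pa b => simp only [brB, map_sub, map_smul, bpar, dpar, dco, deG, gOp]
    | d0 => simp [brB, dco, deG, gOp]
  | d0 =>
    cases D' with
    | di j =>
      simp only [brB, map_smul, bpar, dpar, dco, deG, gOp, add_zero, zero_mul, zero_smul, zero_sub]
      rw [xorE_comm, mulSgn_swap q r, ← neg_smul]
      congr 1
      ring
    | pa b =>
      simp only [brB, map_smul, bpar, dpar, dco, deG, gOp, add_zero, zero_mul, zero_smul, zero_sub]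
      rw [← neg_smul]
      congr 1
      ring
    | d0 => simp [brB, dco]

lemma gOp_mul_aOp (s : LExp m) (q : GExp n) (D : Dir m n true) (p : LExp m) (r : GExp n) :
    gOp ρ s q D * aOp ρ p r
      = (dco D p r * mulSgn q (deG D r)) • aOp ρ (s + p) (xorE q (deG D r))
        + (-1 : ℂ) ^ (bpar q D * gdeg r) • (aOp ρ p r * gOp ρ s q D) := by
  have h := ρ.leibniz (s, q, D) (p, r)
  rw [neg_one_pow_mul_congr (neg_one_pow_par s q D) (neg_one_pow_apar p r)] at h
  refine h.trans ?_
  congr 1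
  cases D <;> simp [wOnA, dco, deG, aOp]

lemma wOp_bracket (s : LExp m) (q : GExp n) (D : Dir m n true) (p : LExp m) (r : GExp n)
    (D' : Dir m n true) :
    wOp ρ s q D * wOp ρ p r D' - (-1 : ℂ) ^ (bpar q D * bpar r D') • (wOp ρ p r D' * wOp ρ s q D)
      = (dco D p r * mulSgn q (deG D r)) • wOp ρ (s + p - dsh D) (xorE q (deG D r)) D'
        - ((-1 : ℂ) ^ (bpar q D * bpar r D') * dco D' s q * mulSgn r (deG D' q)) •
          wOp ρ (p + s - dsh D') (xorE r (deG D' q)) D := by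
  rw [wOp, wOp, gOp_bracket, wOp, wOp]
  have e1 : s + p - dsh D - dsh D' = s - dsh D + (p - dsh D') := by abel
  have e2 : p + s - dsh D' - dsh D = s - dsh D + (p - dsh D') := by abel
  rw [e1, e2]
  set x := s - dsh D + (p - dsh D')
  have trivialCase : dco D (p - dsh D') r = dco D p r → dco D' (s - dsh D) q = dco D' s q →
      (dco D (p - dsh D') r * mulSgn q (deG D r)) • gOp ρ x (xorE q (deG D r)) D'
        - ((-1 : ℂ) ^ (bpar q D * bpar r D') * dco D' (s - dsh D) q * mulSgn r (deG D' q)) •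
          gOp ρ x (xorE r (deG D' q)) D
      = (dco D p r * mulSgn q (deG D r)) • gOp ρ x (xorE q (deG D r)) D'
        - ((-1 : ℂ) ^ (bpar q D * bpar r D') * dco D' s q * mulSgn r (deG D' q)) •
          gOp ρ x (xorE r (deG D' q)) D := fun h1 h2 => by rw [h1, h2]
  cases D with
  | di i =>
    cases D' with
    | di j =>
      by_cases hij : i = j
      · subst hij
        simp only [dco, deG, dsh, Pi.sub_apply, Pi.single_eq_same, bpar, dpar, add_zero]
        rw [xorE_comm r q, mulSgn_swap q r, ← sub_smul, ← sub_smul]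
        congr 1
        push_cast
        ring
      · exact trivialCase (by simp [dco, dsh, hij]) (by simp [dco, dsh, Ne.symm hij])
    | pa b => exact trivialCase (by simp [dco, dsh]) (by simp [dco])
    | d0 => exact trivialCase (by simp [dco, dsh]) (by simp [dco])
  | pa a => exact trivialCase (by simp [dco]) (by simp [dsh])
  | d0 => exact trivialCase (by simp [dco]) (by simp [dsh])

lemma wOp_mul_aOp (s : LExp m) (q : GExp n) (D : Dir m n true) (p : LExp m) (r : GExp n) :
    wOp ρ s q D * aOp ρ p r
      = (dco D p r * mulSgn q (deG D r)) • aOp ρ (s + p - dsh D) (xorE q (deG D r))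
        + (-1 : ℂ) ^ (bpar q D * gdeg r) • (aOp ρ p r * wOp ρ s q D) := by
  rw [wOp, gOp_mul_aOp, sub_add_eq_add_sub]

@[simp] lemma dco_zero_gnil (D : Dir m n true) : dco D 0 gnil = 0 := by
  cases D <;> simp [dco]

lemma oOp_bracket (s : LExp m) (q : GExp n) (D : Dir m n true) (p : LExp m) (r : GExp n)
    (D' : Dir m n true) :
    oOp ρ s q D * oOp ρ p r D' - (-1 : ℂ) ^ (bpar q D * bpar r D') • (oOp ρ p r D' * oOp ρ s q D)
      = dco D p r • (mulSgn q (deG D r) • oOp ρ (s + p - dsh D) (xorE q (deG D r)) D'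
          - gaug q • oOp ρ (p - dsh D) (deG D r) D')
        - ((-1 : ℂ) ^ (bpar q D * bpar r D') * dco D' s q) •
          (mulSgn r (deG D' q) • oOp ρ (p + s - dsh D') (xorE r (deG D' q)) D
            - gaug r • oOp ρ (s - dsh D') (deG D' q) D) := by
  have h1 := wOp_bracket ρ s q D p r D'
  have h2 := congrArg (gaug r • ·) (wOp_bracket ρ s q D 0 gnil D')
  have h3 := congrArg (gaug q • ·) (wOp_bracket ρ 0 gnil D p r D')
  have h4 := congrArg (fun x => gaug q • gaug r • x) (wOp_bracket ρ 0 gnil D 0 gnil D')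
  simp only [dco_zero_gnil, zero_mul, mul_zero, zero_smul, gnil_mulSgn, gnil_xorE, mul_one,
    zero_add, sub_zero, zero_sub] at h2 h3 h4
  have k1 : gaug r * (-1 : ℂ) ^ (bpar q D * bpar (gnil : GExp n) D')
      = gaug r * (-1 : ℂ) ^ (bpar q D * bpar r D') := by
    by_cases h : r = gnil
    · rw [h]
    · simp [gaug_of_ne h]
  have k2 : gaug q * (-1 : ℂ) ^ (bpar (gnil : GExp n) D * bpar r D')
      = gaug q * (-1 : ℂ) ^ (bpar q D * bpar r D') := by
    by_cases h : q = gnil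
    · rw [h]
    · simp [gaug_of_ne h]
  have k3 : gaug q * gaug r * (-1 : ℂ) ^ (bpar (gnil : GExp n) D * bpar (gnil : GExp n) D')
      = gaug q * gaug r * (-1 : ℂ) ^ (bpar q D * bpar r D') := by
    by_cases h : q = gnil
    · by_cases h' : r = gnil
      · rw [h, h']
      · simp [gaug_of_ne h']
    · simp [gaug_of_ne h]
  have g1 := mulSgn_mul_gaug q (deG D r)
  have g2 := mulSgn_mul_gaug r (deG D' q)
  simp only [smul_sub, smul_smul, ← mul_assoc, k1, k2, k3, smul_zero, smul_neg] at h2 h3 h4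
  simp only [oOp, sub_mul, mul_sub, smul_mul_assoc, mul_smul_comm, smul_sub, smul_smul]
  linear_combination (norm := module) h1 - h2 - h3 + h4
    + (dco D p r • g1) • wOp ρ 0 gnil D'
    - (((-1 : ℂ) ^ (bpar q D * bpar r D') * dco D' s q) • g2) • wOp ρ 0 gnil D

end Operators

/-! ### The fibre of a weight `AV`-module -/

section Diagonal

variable {ι J V : Type*} [AddCommGroup V] [Module ℂ V]

/-- The diagonal operator on `ι →₀ V` with eigenvalues `c`. -/
noncomputable def diagMap (c : ι → ℂ) : (ι →₀ V) →ₗ[ℂ] (ι →₀ V) :=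
  Finsupp.lsum ℂ fun x => c x • Finsupp.lsingle x

lemma diagMap_single (c : ι → ℂ) (x : ι) (v : V) :
    diagMap c (Finsupp.single x v) = c x • Finsupp.single x v := by
  simp [diagMap]

lemma diagMap_apply (c : ι → ℂ) (f : ι →₀ V) (x : ι) : diagMap c f x = c x • f x := by
  classical
  induction f using Finsupp.induction_linear with
  | zero => simp
  | add f g hf hg => rw [map_add, Finsupp.add_apply, hf, hg, Finsupp.add_apply, smul_add]
  | single y v =>
    rw [diagMap_single, Finsupp.smul_apply]
    by_cases h : y = x
    · rw [h]
    · simp [h]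

/-- A subspace of `ι →₀ V` stable under a separating family of diagonal operators contains
a nonzero element supported at one point. -/
lemma exists_single_mem_of_diagonal {K : Submodule ℂ (ι →₀ V)} (c : J → ι → ℂ)
    (hsep : ∀ x y, (∀ j, c j x = c j y) → x = y)
    (hK : ∀ j, ∀ f ∈ K, ∃ f' ∈ K, ∀ x, f' x = c j x • f x) (N : ℕ) :
    ∀ f ∈ K, f.support.card = N → f ≠ 0 → ∃ x v, v ≠ 0 ∧ Finsupp.single x v ∈ K := by
  classical
  induction N using Nat.strong_induction_on with
  | _ N ih =>
    intro f hf hN hf0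
    obtain ⟨x, hx⟩ := Finsupp.support_nonempty_iff.mpr hf0
    by_cases hone : ∀ y ∈ f.support, y = x
    · refine ⟨x, f x, Finsupp.mem_support_iff.mp hx, ?_⟩
      have : f = Finsupp.single x (f x) :=
        Finsupp.support_subset_singleton.mp fun y hy => by simpa using hone y hy
      rwa [← this]
    · push Not at hone
      obtain ⟨y, hy, hyx⟩ := hone
      obtain ⟨j, hj⟩ : ∃ j, c j y ≠ c j x := by
        by_contra hc
        push Not at hc
        exact hyx (hsep y x hc)
      obtain ⟨f', hf', hval⟩ := hK j f hf
      have hval' : ∀ z, (f' - c j x • f) z = (c j z - c j x) • f z := fun z => by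
        rw [Finsupp.sub_apply, hval, Finsupp.smul_apply, sub_smul]
      refine ih _ ?_ (f' - c j x • f) (sub_mem hf' (K.smul_mem _ hf)) rfl ?_
      · rw [← hN]
        refine Finset.card_lt_card (Finset.ssubset_iff_of_subset ?_ |>.mpr ⟨x, hx, ?_⟩)
        · intro z hz
          rw [Finsupp.mem_support_iff, hval'] at hz
          exact Finsupp.mem_support_iff.mpr fun h => hz (by rw [h, smul_zero])
        · simp [hval']
      · intro h0
        have := hval' y
        rw [h0, Finsupp.zero_apply, eq_comm, smul_eq_zero] at this
        rcases this with h | h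
        · exact hj (sub_eq_zero.mp h)
        · exact Finsupp.mem_support_iff.mp hy h

end Diagonal

section Fibre

variable {m n : ℕ} (ρ : AVRep m n true) (l : Fin m → ℂ)

/-- The space of vectors of weight `l + s` with respect to `d_1, …, d_m`. -/
noncomputable def wsp (s : LExp m) : Submodule ℂ ρ.M :=
  ⨅ i, LinearMap.ker (gOp ρ 0 gnil (.di i) - (l i + s i) • (1 : Module.End ℂ ρ.M))

/-- The vectors of weight `l` annihilated by all `∂/∂ξ_α`. -/
noncomputable def fib : Submodule ℂ ρ.M :=
  wsp ρ l 0 ⊓ ⨅ a, LinearMap.ker (gOp ρ 0 gnil (.pa a))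

variable {ρ l}

lemma mem_wsp {s : LExp m} {v : ρ.M} :
    v ∈ wsp ρ l s ↔ ∀ i, gOp ρ 0 gnil (.di i) v = (l i + s i) • v := by
  simp [wsp, sub_eq_zero]

lemma mem_fib {v : ρ.M} :
    v ∈ fib ρ l ↔ v ∈ wsp ρ l 0 ∧ ∀ a, gOp ρ 0 gnil (.pa a) v = 0 := by
  simp [fib]

lemma gOp_di_gOp (i : Fin m) (s : LExp m) (q : GExp n) (D : Dir m n true) (v : ρ.M) :
    gOp ρ 0 gnil (.di i) (gOp ρ s q D v)
      = gOp ρ s q D (gOp ρ 0 gnil (.di i) v) + (s i : ℂ) • gOp ρ s q D v := by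
  have h := congrArg (fun T : Module.End ℂ ρ.M => T v) (gOp_bracket ρ 0 gnil (.di i) s q D)
  have e : dco (.di i : Dir m n true) s q = s i := rfl
  have e' : deG (.di i : Dir m n true) q = q := rfl
  simp only [bpar, dpar, gdeg_gnil, add_zero, zero_mul, pow_zero, one_smul, dco_zero_gnil,
    mul_zero, zero_smul, sub_zero, zero_add, e, e', gnil_mulSgn, mul_one, gnil_xorE,
    LinearMap.sub_apply, Module.End.mul_apply, LinearMap.smul_apply] at h
  rw [← h]
  abel

lemma gOp_di_aOp (i : Fin m) (s : LExp m) (q : GExp n) (v : ρ.M) :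
    gOp ρ 0 gnil (.di i) (aOp ρ s q v)
      = aOp ρ s q (gOp ρ 0 gnil (.di i) v) + (s i : ℂ) • aOp ρ s q v := by
  have h := congrArg (fun T : Module.End ℂ ρ.M => T v) (gOp_mul_aOp ρ 0 gnil (.di i) s q)
  simp only [bpar, dpar, gdeg_gnil, add_zero, zero_mul, pow_zero, one_smul,
    zero_add, dco, deG, gnil_mulSgn, mul_one, gnil_xorE,
    LinearMap.add_apply, Module.End.mul_apply, LinearMap.smul_apply] at h
  rw [h, add_comm]

lemma gOp_pa_gOp (a : Fin n) (s : LExp m) (q : GExp n) (D : Dir m n true) (v : ρ.M) :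
    gOp ρ 0 gnil (.pa a) (gOp ρ s q D v)
      = derC a q • gOp ρ s (derE a q) D v
        + (-1 : ℂ) ^ bpar q D • gOp ρ s q D (gOp ρ 0 gnil (.pa a) v) := by
  have h := congrArg (fun T : Module.End ℂ ρ.M => T v) (gOp_bracket ρ 0 gnil (.pa a) s q D)
  have e : dco (.pa a : Dir m n true) s q = derC a q := rfl
  have e' : deG (.pa a : Dir m n true) q = derE a q := rfl
  simp only [dco_zero_gnil,
    mul_zero, zero_mul, zero_smul, sub_zero, zero_add, e, e', gnil_mulSgn, mul_one, gnil_xorE,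
    LinearMap.sub_apply, Module.End.mul_apply, LinearMap.smul_apply] at h
  rw [← h]
  simp [bpar, dpar]

lemma gOp_pa_aOp (a : Fin n) (s : LExp m) (q : GExp n) (v : ρ.M) :
    gOp ρ 0 gnil (.pa a) (aOp ρ s q v)
      = derC a q • aOp ρ s (derE a q) v
        + (-1 : ℂ) ^ gdeg q • aOp ρ s q (gOp ρ 0 gnil (.pa a) v) := by
  have h := congrArg (fun T : Module.End ℂ ρ.M => T v) (gOp_mul_aOp ρ 0 gnil (.pa a) s q)
  simp only [zero_add, dco, deG, gnil_mulSgn, mul_one, gnil_xorE,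
    LinearMap.add_apply, Module.End.mul_apply, LinearMap.smul_apply] at h
  rw [h]
  simp [bpar, dpar]

lemma gOp_mem_wsp {s : LExp m} (p : LExp m) (q : GExp n) (D : Dir m n true) {v : ρ.M}
    (hv : v ∈ wsp ρ l s) : gOp ρ p q D v ∈ wsp ρ l (p + s) := by
  refine mem_wsp.mpr fun i => ?_
  rw [gOp_di_gOp, mem_wsp.mp hv i, map_smul]
  simp only [Pi.add_apply, Int.cast_add]
  module

lemma aOp_mem_wsp {s : LExp m} (p : LExp m) (q : GExp n) {v : ρ.M}
    (hv : v ∈ wsp ρ l s) : aOp ρ p q v ∈ wsp ρ l (p + s) := by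
  refine mem_wsp.mpr fun i => ?_
  rw [gOp_di_aOp, mem_wsp.mp hv i, map_smul]
  simp only [Pi.add_apply, Int.cast_add]
  module

lemma aOp_aOp (s p : LExp m) (q r : GExp n) (v : ρ.M) :
    aOp ρ s q (aOp ρ p r v) = mulSgn q r • aOp ρ (s + p) (xorE q r) v :=
  congrArg (fun T : Module.End ℂ ρ.M => T v) (aOp_mul ρ s p q r)

lemma aOp_one (v : ρ.M) : aOp ρ 0 gnil v = v :=
  congrArg (fun T : Module.End ℂ ρ.M => T v) (aOp_zero_gnil ρ)

lemma aOp_neg_aOp (s : LExp m) (q : GExp n) (v : ρ.M) :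
    aOp ρ (-s) gnil (aOp ρ s q v) = aOp ρ 0 q v := by
  simp [aOp_aOp]

variable (ρ l) in
/-- The map `A ⊗ V' → M` attached to the fibre `V'`. -/
noncomputable def fibMap : (ABasis m n →₀ fib ρ l) →ₗ[ℂ] ρ.M :=
  Finsupp.lsum ℂ fun x => (aOp ρ x.1 x.2) ∘ₗ (fib ρ l).subtype

lemma fibMap_single (x : ABasis m n) (v : fib ρ l) :
    fibMap ρ l (Finsupp.single x v) = aOp ρ x.1 x.2 v := by
  simp [fibMap]

lemma aOp_mem_range (s : LExp m) (q : GExp n) {v : ρ.M}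
    (hv : v ∈ LinearMap.range (fibMap ρ l)) : aOp ρ s q v ∈ LinearMap.range (fibMap ρ l) := by
  obtain ⟨f, rfl⟩ := hv
  induction f using Finsupp.induction_linear with
  | zero => simp
  | add f g hf hg => rw [map_add, map_add]; exact add_mem hf hg
  | single x v =>
    rw [fibMap_single, aOp_aOp]
    refine Submodule.smul_mem _ _ ⟨Finsupp.single (s + x.1, xorE q x.2) v, ?_⟩
    rw [fibMap_single]

lemma gOp_pa_anticomm (a b : Fin n) (v : ρ.M) :
    gOp ρ 0 gnil (.pa a) (gOp ρ 0 gnil (.pa b) v)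
      = - gOp ρ 0 gnil (.pa b) (gOp ρ 0 gnil (.pa a) v) := by
  rw [gOp_pa_gOp]
  simp [bpar, dpar]

lemma mem_range_of_mem_wsp_zero (T : Finset (Fin n)) : ∀ u ∈ wsp ρ l 0,
    (∀ a ∉ T, gOp ρ 0 gnil (.pa a) u = 0) → u ∈ LinearMap.range (fibMap ρ l) := by
  classical
  induction T using Finset.induction_on with
  | empty =>
    intro u hu h
    refine ⟨Finsupp.single (0, gnil) ⟨u, mem_fib.mpr ⟨hu, fun a => h a (by simp)⟩⟩, ?_⟩
    rw [fibMap_single]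
    exact aOp_one u
  | insert a T ha ih =>
    intro u hu h
    have hsq : gOp ρ 0 gnil (.pa a) (gOp ρ 0 gnil (.pa a) u) = 0 := by
      have := gOp_pa_anticomm a a u
      rwa [eq_neg_iff_add_eq_zero, ← two_smul ℂ, smul_eq_zero_iff_right two_ne_zero] at this
    have h2w : gOp ρ 0 gnil (.pa a) u ∈ wsp ρ l 0 := by
      simpa using gOp_mem_wsp 0 gnil (.pa a) hu
    have h2 : gOp ρ 0 gnil (.pa a) u ∈ LinearMap.range (fibMap ρ l) := by
      refine ih _ h2w fun b hb => ?_
      by_cases hab : b = a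
      · rw [hab, hsq]
      · rw [gOp_pa_anticomm, h b (by simp [hab, hb]), map_zero, neg_zero]
    have h1 : u - aOp ρ 0 (gone a) (gOp ρ 0 gnil (.pa a) u) ∈ LinearMap.range (fibMap ρ l) := by
      refine ih _ (sub_mem hu (by simpa using aOp_mem_wsp 0 (gone a) h2w)) fun b hb => ?_
      rw [map_sub, gOp_pa_aOp]
      by_cases hab : b = a
      · subst hab
        simp [hsq, aOp_one]
      · rw [gOp_pa_anticomm b a, h b (by simp [hab, hb]), derC_gone_of_ne hab]
        simp
    have := add_mem h1 (aOp_mem_range 0 (gone a) h2)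
    rwa [sub_add_cancel] at this

lemma range_fibMap (hsup : ⨆ s, wsp ρ l s = ⊤) : LinearMap.range (fibMap ρ l) = ⊤ := by
  rw [eq_top_iff, ← hsup]
  refine iSup_le fun s u hu => ?_
  have h1 : aOp ρ (-s) gnil u ∈ wsp ρ l 0 := by simpa using aOp_mem_wsp (-s) gnil hu
  have h2 := aOp_mem_range s gnil
    (mem_range_of_mem_wsp_zero Finset.univ _ h1 fun a ha => absurd (Finset.mem_univ a) ha)
  rwa [aOp_aOp, add_neg_cancel, gnil_mulSgn, one_smul, gnil_xorE, aOp_one] at h2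

lemma eq_zero_of_aOp_zero {v : ρ.M} (hv : v ∈ fib ρ l) (N : ℕ) :
    ∀ q : GExp n, gdeg q = N → aOp ρ 0 q v = 0 → v = 0 := by
  induction N with
  | zero =>
    intro q hq h
    rwa [gdeg_eq_zero_iff.mp hq, aOp_one] at h
  | succ N ih =>
    intro q hq h
    obtain ⟨a, ha⟩ : ∃ a, q a = true := by
      by_contra hc
      push Not at hc
      have : q = gnil := funext fun a => by simpa [gnil] using hc a
      simp [this] at hq
    refine ih (derE a q) (by have := gdeg_derE ha; omega) ?_
    have := gOp_pa_aOp a 0 q v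
    rw [h, (mem_fib.mp hv).2 a, map_zero, map_zero, smul_zero, add_zero, eq_comm,
      smul_eq_zero_iff_right (derC_ne_zero ha)] at this
    exact this

lemma eq_zero_of_aOp {v : ρ.M} (hv : v ∈ fib ρ l) {s : LExp m} {q : GExp n}
    (h : aOp ρ s q v = 0) : v = 0 := by
  refine eq_zero_of_aOp_zero hv _ q rfl ?_
  rw [← aOp_neg_aOp s, h, map_zero]

lemma fibMap_injective : Function.Injective (fibMap ρ l) := by
  rw [← LinearMap.ker_eq_bot]
  by_contra hne
  obtain ⟨f, hf, hf0⟩ := (Submodule.ne_bot_iff _).mp hne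
  let c : Fin m ⊕ Fin n → ABasis m n → ℂ
    | .inl i, x => l i + x.1 i
    | .inr a, x => if x.2 a = true then 1 else 0
  let T : Fin m ⊕ Fin n → Module.End ℂ ρ.M
    | .inl i => gOp ρ 0 gnil (.di i)
    | .inr a => aOp ρ 0 (gone a) * gOp ρ 0 gnil (.pa a)
  have hT : ∀ j x (v : fib ρ l), T j (aOp ρ x.1 x.2 v) = c j x • aOp ρ x.1 x.2 v := by
    rintro (i | a) ⟨r, q⟩ v
    · have := mem_wsp.mp (aOp_mem_wsp r q (mem_fib.mp v.2).1) i
      simpa [T, c] using this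
    · simp only [T, c, Module.End.mul_apply, gOp_pa_aOp, (mem_fib.mp v.2).2 a, map_zero, smul_zero,
        add_zero, map_smul, aOp_aOp, zero_add]
      split_ifs with h
      · rw [smul_smul, derC_mul_mulSgn h, xorE_gone_derE h]
      · rw [derC_of_false (by simpa using h)]
        simp
  obtain ⟨x, v, hv, hx⟩ := exists_single_mem_of_diagonal (K := LinearMap.ker (fibMap ρ l)) c
    (by
      rintro ⟨r, q⟩ ⟨r', q'⟩ h
      have h1 : r = r' := funext fun i => by simpa [c] using h (.inl i)
      have h2 : q = q' := funext fun a => by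
        have := h (.inr a)
        simp only [c] at this
        cases hq : q a <;> cases hq' : q' a <;> simp [hq, hq'] at this ⊢
      rw [h1, h2])
    (by
      intro j f hf
      refine ⟨diagMap (c j) f, ?_, diagMap_apply (c j) f⟩
      rw [LinearMap.mem_ker] at hf ⊢
      have key : fibMap ρ l ∘ₗ diagMap (c j) = T j ∘ₗ fibMap ρ l := by
        refine Finsupp.lhom_ext fun x v => ?_
        simp [diagMap_single, fibMap_single, hT]
      rw [← LinearMap.comp_apply, key, LinearMap.comp_apply, hf, map_zero])
    _ f hf rfl hf0
  rw [LinearMap.mem_ker, fibMap_single] at hx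
  exact hv (Subtype.ext (eq_zero_of_aOp v.2 hx))

end Fibre

section Fibre

variable {m n : ℕ} {ρ : AVRep m n true} {l : Fin m → ℂ} (hsup : ⨆ s, wsp ρ l s = ⊤)

/-- The isomorphism `A ⊗ V' ≃ M`. -/
noncomputable def fibEquiv : (ABasis m n →₀ fib ρ l) ≃ₗ[ℂ] ρ.M :=
  LinearEquiv.ofBijective (fibMap ρ l)
    ⟨fibMap_injective, LinearMap.range_eq_top.mp (range_fibMap hsup)⟩

/-- The evaluation `M → V'` at the point `t = 1, ξ = 0`. -/
noncomputable def fibProj : ρ.M →ₗ[ℂ] fib ρ l :=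
  (Finsupp.lsum ℂ fun x : ABasis m n => gaug x.2 • (LinearMap.id : fib ρ l →ₗ[ℂ] fib ρ l)) ∘ₗ
    (fibEquiv hsup).symm.toLinearMap

/-- The jets of the vector fields at the point `t = 1, ξ = 0`, acting on the fibre. -/
noncomputable def fibJet (s : LExp m) (q : GExp n) (D : Dir m n true) :
    Module.End ℂ (fib ρ l) :=
  fibProj hsup ∘ₗ oOp ρ s q D ∘ₗ (fib ρ l).subtype

lemma fibEquiv_apply (f : ABasis m n →₀ fib ρ l) : fibEquiv hsup f = fibMap ρ l f := rfl

include hsup in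
lemma linearMap_ext_aOp {X : Type*} [AddCommGroup X] [Module ℂ X] {f g : ρ.M →ₗ[ℂ] X}
    (h : ∀ s q, ∀ v ∈ fib ρ l, f (aOp ρ s q v) = g (aOp ρ s q v)) : f = g := by
  have : f ∘ₗ fibMap ρ l = g ∘ₗ fibMap ρ l := by
    refine Finsupp.lhom_ext fun x v => ?_
    simpa [fibMap_single] using h x.1 x.2 v v.2
  ext z
  obtain ⟨w, rfl⟩ := (fibEquiv hsup).surjective z
  exact congrArg (fun T : _ →ₗ[ℂ] X => T w) this

lemma fibProj_aOp_coe (s : LExp m) (q : GExp n) (v : fib ρ l) :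
    fibProj hsup (aOp ρ s q v) = gaug q • v := by
  have : (fibEquiv hsup).symm (aOp ρ s q v) = Finsupp.single (s, q) v := by
    rw [LinearEquiv.symm_apply_eq, fibEquiv_apply, fibMap_single]
  simp [fibProj, this]

lemma fibProj_coe (v : fib ρ l) : fibProj hsup (v : ρ.M) = v := by
  have := fibProj_aOp_coe hsup 0 gnil v
  rwa [aOp_one, gaug_gnil, one_smul] at this

lemma fibProj_aOp (s : LExp m) (q : GExp n) (z : ρ.M) :
    fibProj hsup (aOp ρ s q z) = gaug q • fibProj hsup z := by
  have : fibProj hsup ∘ₗ aOp ρ s q = gaug q • fibProj hsup := by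
    refine linearMap_ext_aOp hsup fun p r v hv => ?_
    have h1 := fibProj_aOp_coe hsup (s + p) (xorE q r) ⟨v, hv⟩
    have h2 := fibProj_aOp_coe hsup p r ⟨v, hv⟩
    simp only at h1 h2
    rw [LinearMap.comp_apply, aOp_aOp, map_smul, h1, LinearMap.smul_apply, h2, smul_smul,
      smul_smul, mulSgn_mul_gaug]
  exact congrArg (fun T : ρ.M →ₗ[ℂ] _ => T z) this

lemma fibProj_wOp_aOp (s : LExp m) (q : GExp n) (D : Dir m n true) (p : LExp m) (r : GExp n)
    (z : ρ.M) :
    fibProj hsup (wOp ρ s q D (aOp ρ p r z))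
      = (dco D p r * (gaug q * gaug (deG D r))) • fibProj hsup z
        + gaug r • fibProj hsup (wOp ρ s q D z) := by
  have h := congrArg (fun T : Module.End ℂ ρ.M => T z) (wOp_mul_aOp ρ s q D p r)
  simp only [LinearMap.add_apply, Module.End.mul_apply, LinearMap.smul_apply] at h
  rw [h, map_add, map_smul, map_smul, fibProj_aOp, fibProj_aOp, smul_smul, smul_smul, mul_assoc,
    mulSgn_mul_gaug]
  congr 2
  by_cases hr : r = gnil
  · simp [hr]
  · simp [gaug_of_ne hr]

lemma fibProj_oOp (s : LExp m) (q : GExp n) (D : Dir m n true) (z : ρ.M) :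
    fibProj hsup (oOp ρ s q D z) = fibJet hsup s q D (fibProj hsup z) := by
  have : fibProj hsup ∘ₗ oOp ρ s q D = fibJet hsup s q D ∘ₗ fibProj hsup := by
    refine linearMap_ext_aOp hsup fun p r v hv => ?_
    have h2 := fibProj_aOp_coe hsup p r ⟨v, hv⟩
    simp only at h2
    simp only [LinearMap.comp_apply, h2, map_smul, fibJet, Submodule.subtype_apply, oOp,
      LinearMap.sub_apply, LinearMap.smul_apply, map_sub, fibProj_wOp_aOp, gaug_gnil]
    module
  exact congrArg (fun T : ρ.M →ₗ[ℂ] _ => T z) this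

lemma isJet_fibJet : IsJet (fibJet hsup) where
  zero D := by
    have : oOp ρ 0 gnil D = 0 := by simp [oOp]
    simp [fibJet, this]
  br s q D p r D' := by
    ext1 v
    have h := congrArg (fun T : Module.End ℂ ρ.M => fibProj hsup (T v))
      (oOp_bracket ρ s q D p r D')
    simp only [LinearMap.sub_apply, Module.End.mul_apply, LinearMap.smul_apply, map_sub, map_smul,
      fibProj_oOp, fibProj_coe] at h
    simpa only [LinearMap.sub_apply, Module.End.mul_apply, LinearMap.smul_apply] using h

include hsup in
lemma finiteDimensional_fib (hfr : IsFiniteRank ρ) : FiniteDimensional ℂ (fib ρ l) := by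
  classical
  obtain ⟨S, hS⟩ := hfr
  refine ⟨⟨S.image (fibProj hsup), ?_⟩⟩
  rw [eq_top_iff]
  rintro v -
  have hv : (v : ρ.M) ∈ (⊤ : Submodule ℂ ρ.M) := trivial
  rw [← hS] at hv
  have h1 : ∀ z ∈ Submodule.span ℂ {v : ρ.M | ∃ f : ABasis m n, ∃ s ∈ S, v = ρ.aact (asng f) s},
      fibProj hsup z ∈ Submodule.span ℂ (↑(S.image (fibProj hsup)) : Set (fib ρ l)) := by
    intro z hz
    induction hz using Submodule.span_induction with
    | zero => simp
    | add x y _ _ hx hy => rw [map_add]; exact add_mem hx hy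
    | smul c x _ hx => rw [map_smul]; exact Submodule.smul_mem _ _ hx
    | mem x hx =>
      obtain ⟨⟨p, q⟩, s, hs, rfl⟩ := hx
      have := fibProj_aOp hsup p q s
      rw [aOp] at this
      rw [this]
      exact Submodule.smul_mem _ _
        (Submodule.subset_span (Finset.mem_coe.mpr (Finset.mem_image_of_mem _ hs)))
  have := h1 v hv
  rwa [fibProj_coe] at this

/-- The scalar by which `d_i`, `∂/∂ξ_α`, `d_0` act on the fibre. -/
noncomputable def fibScalar (l : Fin m → ℂ) (l0 : ℂ) : Dir m n true → ℂ
  | .di i => l i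
  | .pa _ => 0
  | .d0 => l0

variable {l0 : ℂ} (hd0 : ∀ v : ρ.M, gOp ρ 0 gnil .d0 v = l0 • v)

include hd0 in
lemma gOp_zero_gnil_fib (D : Dir m n true) (v : fib ρ l) :
    gOp ρ 0 gnil D v = fibScalar l l0 D • (v : ρ.M) := by
  cases D with
  | di i => simpa [fibScalar] using mem_wsp.mp (mem_fib.mp v.2).1 i
  | pa a => simpa [fibScalar] using (mem_fib.mp v.2).2 a
  | d0 => exact hd0 v

/-- The expected value of `t^s ξ^q D` on the fibre. -/
noncomputable def fibFormula (l0 : ℂ) (s : LExp m) (q : GExp n) (D : Dir m n true) (v : fib ρ l) :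
    ρ.M :=
  fibScalar l l0 D • aOp ρ s q v
    + ∑ i, (s i : ℂ) • aOp ρ s q (fibJet hsup (Pi.single i 1) gnil D v)
    + ∑ a, ((-1 : ℂ) ^ (gdeg q + 1) * derC a q) •
        aOp ρ s (derE a q) (fibJet hsup 0 (gone a) D v)

include hd0 in
lemma fibProj_gOp {v : fib ρ l} (hv : ∀ s q D, fibJet hsup s q D v
      = linPart (fibJet hsup) s q D v) (s : LExp m) (q : GExp n) (D : Dir m n true) :
    fibProj hsup (gOp ρ s q D v)
      = (gaug q * fibScalar l l0 D) • v + linPart (fibJet hsup) s q D v := by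
  have e1 : ∀ (s : LExp m) (q : GExp n), fibProj hsup (gOp ρ s q D v)
      = linPart (fibJet hsup) (s + dsh D) q D v
        + gaug q • fibProj hsup (wOp ρ 0 gnil D v) := by
    intro s q
    rw [← hv]
    simp [fibJet, oOp, wOp]
  have e2 := e1 0 gnil
  rw [gOp_zero_gnil_fib hd0, map_smul, fibProj_coe, gaug_gnil, one_smul, zero_add,
    ← sub_eq_iff_eq_add'] at e2
  rw [e1, ← e2]
  have e3 := congrArg (fun T : Module.End ℂ (fib ρ l) => T v)
    (linPart_add_sub (B := fibJet hsup) s (dsh D) q D)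
  simp only [LinearMap.sub_apply, LinearMap.smul_apply] at e3
  rw [← e3]
  module

lemma neg_one_pow_mul_derC_mul_gaug (a : Fin n) (q : GExp n) :
    (-1 : ℂ) ^ (gdeg q + 1) * derC a q * gaug (derE a q) = if q = gone a then 1 else 0 := by
  split_ifs with h
  · simp [h]
  · by_cases ha : q a = true
    · have : derE a q ≠ gnil := fun h0 => h (by
        rw [← xorE_gone_derE ha, h0, xorE_comm, gnil_xorE])
      simp [gaug_of_ne this]
    · simp [derC_of_false (by simpa using ha : q a = false)]

lemma fibProj_fibFormula (s : LExp m) (q : GExp n) (D : Dir m n true) (v : fib ρ l) :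
    fibProj hsup (fibFormula hsup l0 s q D v)
      = (gaug q * fibScalar l l0 D) • v + linPart (fibJet hsup) s q D v := by
  simp only [fibFormula, map_add, map_smul, map_sum, fibProj_aOp_coe, smul_smul,
    neg_one_pow_mul_derC_mul_gaug, linPart, LinearMap.add_apply, LinearMap.smul_apply,
    LinearMap.sum_apply, Finset.smul_sum]
  rw [add_assoc, mul_comm (gaug q)]
  congr 2
  exact Finset.sum_congr rfl fun i _ => by rw [mul_comm]

lemma fibFormula_mem_wsp (s : LExp m) (q : GExp n) (D : Dir m n true) (v : fib ρ l) :
    fibFormula hsup l0 s q D v ∈ wsp ρ l s := by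
  have h : ∀ (r : GExp n) (u : fib ρ l), aOp ρ s r u ∈ wsp ρ l s := fun r u => by
    simpa using aOp_mem_wsp s r (mem_fib.mp u.2).1
  exact add_mem (add_mem (Submodule.smul_mem _ _ (h _ _))
    (Submodule.sum_mem _ fun i _ => Submodule.smul_mem _ _ (h _ _)))
    (Submodule.sum_mem _ fun i _ => Submodule.smul_mem _ _ (h _ _))

lemma gOp_pa_aOp_fib (a : Fin n) (s : LExp m) (q : GExp n) (u : fib ρ l) :
    gOp ρ 0 gnil (.pa a) (aOp ρ s q u) = derC a q • aOp ρ s (derE a q) u := by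
  rw [gOp_pa_aOp, (mem_fib.mp u.2).2 a, map_zero, smul_zero, add_zero]

lemma gOp_pa_fibFormula (b : Fin n) (s : LExp m) (q : GExp n) (D : Dir m n true) (v : fib ρ l) :
    gOp ρ 0 gnil (.pa b) (fibFormula hsup l0 s q D v)
      = derC b q • fibFormula hsup l0 s (derE b q) D v := by
  simp only [fibFormula, map_add, map_smul, map_sum, gOp_pa_aOp_fib, smul_add, Finset.smul_sum,
    smul_smul]
  congr 1
  · congr 1
    · rw [mul_comm]
    · exact Finset.sum_congr rfl fun i _ => by rw [mul_comm]
  · refine Finset.sum_congr rfl fun a _ => ?_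
    rw [derE_comm a b]
    congr 1
    by_cases hb : q b = true
    · have h := derC_mul_derC_derE a b q
      rw [← gdeg_derE hb, pow_succ, pow_succ]
      linear_combination (-1 : ℂ) ^ gdeg (derE b q) * h
    · have hb' : q b = false := by simpa using hb
      rw [mul_assoc, derC_mul_derC_derE, derC_of_false hb']
      simp

include hd0 in
lemma gOp_fib {v : fib ρ l} (hv : ∀ s q D, fibJet hsup s q D v
      = linPart (fibJet hsup) s q D v) (s : LExp m) (D : Dir m n true) (N : ℕ) :
    ∀ q : GExp n, gdeg q = N → gOp ρ s q D v = fibFormula hsup l0 s q D v := by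
  induction N using Nat.strong_induction_on with
  | _ N ih =>
    intro q hq
    have hw : gOp ρ s q D v - fibFormula hsup l0 s q D v ∈ wsp ρ l s :=
      sub_mem (by simpa using gOp_mem_wsp s q D (mem_fib.mp v.2).1)
        (fibFormula_mem_wsp hsup s q D v)
    have hpa : ∀ b, gOp ρ 0 gnil (.pa b) (gOp ρ s q D v - fibFormula hsup l0 s q D v) = 0 := by
      intro b
      rw [map_sub, gOp_pa_gOp, (mem_fib.mp v.2).2 b, gOp_pa_fibFormula, map_zero, smul_zero,
        add_zero]
      by_cases hb : q b = true
      · rw [ih (gdeg (derE b q)) (by have := gdeg_derE hb; omega) _ rfl, sub_self]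
      · rw [derC_of_false (by simpa using hb), zero_smul, zero_smul, sub_self]
    have hpr : fibProj hsup (gOp ρ s q D v - fibFormula hsup l0 s q D v) = 0 := by
      rw [map_sub, fibProj_gOp hsup hd0 hv, fibProj_fibFormula, sub_self]
    set z := gOp ρ s q D v - fibFormula hsup l0 s q D v with hz
    have hzf : aOp ρ (-s) gnil z ∈ fib ρ l := by
      refine mem_fib.mpr ⟨by simpa using aOp_mem_wsp (-s) gnil hw, fun b => ?_⟩
      rw [gOp_pa_aOp, hpa b]
      simp
    have h0 : aOp ρ (-s) gnil z = 0 := by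
      have h1 := fibProj_coe hsup ⟨_, hzf⟩
      rw [fibProj_aOp, hpr, smul_zero] at h1
      exact (congrArg Subtype.val h1).symm
    have h2 : aOp ρ s gnil (aOp ρ (-s) gnil z) = z := by
      rw [aOp_aOp]
      simp [aOp_one]
    rw [h0, map_zero] at h2
    exact sub_eq_zero.mp h2.symm

end Fibre

section Fibre

variable {m n : ℕ}

/-- The exponents of the coordinate attached to an index of `gl(m,n)`. -/
def glExp : GlIdx m n → LExp m × GExp n
  | .inl i => (Pi.single i 1, gnil)
  | .inr a => (0, gone a)

/-- The direction attached to an index of `gl(m,n)`. -/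
def glDir : GlIdx m n → Dir m n true
  | .inl i => .di i
  | .inr a => .pa a

lemma bpar_glExp_glDir (x y : GlIdx m n) : bpar (glExp x).2 (glDir y) = gpar x + gpar y := by
  cases x <;> cases y <;> simp [bpar, glExp, glDir, gpar, dpar]

lemma dco_glDir_glExp (y z : GlIdx m n) :
    dco (glDir y) (glExp z).1 (glExp z).2 = if y = z then 1 else 0 := by
  cases y with
  | inl i =>
    cases z with
    | inl j => simp [dco, glExp, glDir, Pi.single_apply]
    | inr b => simp [dco, glExp, glDir]
  | inr a =>
    cases z with
    | inl j => simp [dco, glExp, glDir]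
    | inr b =>
      by_cases h : a = b
      · simp [dco, glExp, glDir, h]
      · simp [dco, glExp, glDir, h, derC_gone_of_ne h]

lemma dsh_glDir (y : GlIdx m n) : dsh (glDir y) = (glExp y).1 := by
  cases y <;> rfl

lemma deG_glDir (y : GlIdx m n) : deG (glDir y) (glExp y).2 = gnil := by
  cases y <;> simp [deG, glDir, glExp]

/-- The `gl(m,n)`-module given by the linear jets. -/
@[reducible] def IsJet.glRep {V : Type} [AddCommGroup V] [Module ℂ V]
    {B : LExp m → GExp n → Dir m n true → Module.End ℂ V} (hB : IsJet B) : GlRep m n where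
  V := V
  ρ x y := B (glExp x).1 (glExp x).2 (glDir y)
  rel x y z w := by
    have h := hB.br (glExp x).1 (glExp x).2 (glDir y) (glExp z).1 (glExp z).2 (glDir w)
    rw [bpar_glExp_glDir, bpar_glExp_glDir, dco_glDir_glExp, dco_glDir_glExp] at h
    rw [h]
    congr 1
    · split_ifs with hyz
      · subst hyz
        simp [dsh_glDir, deG_glDir, hB.zero]
      · simp
    · split_ifs with hwx
      · subst hwx
        simp [dsh_glDir, deG_glDir, hB.zero]
      · simp

variable {ρ : AVRep m n true} {l : Fin m → ℂ} (hsup : ⨆ s, wsp ρ l s = ⊤)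
  {l0 : ℂ} (hd0 : ∀ v : ρ.M, gOp ρ 0 gnil .d0 v = l0 • v)

lemma fibFormula_mem {N : Submodule ℂ (fib ρ l)} {K : Submodule ℂ ρ.M}
    (hK : ∀ s q, ∀ v ∈ N, aOp ρ s q v ∈ K)
    (hN : ∀ x D, ∀ v ∈ N, fibJet hsup (glExp x).1 (glExp x).2 D v ∈ N)
    (s : LExp m) (q : GExp n) (D : Dir m n true) {v : fib ρ l} (hv : v ∈ N) :
    fibFormula hsup l0 s q D v ∈ K :=
  add_mem (add_mem (K.smul_mem _ (hK _ _ _ hv))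
      (K.sum_mem fun i _ => K.smul_mem _ (hK _ _ _ (hN (.inl i) D v hv))))
    (K.sum_mem fun a _ => K.smul_mem _ (hK _ _ _ (hN (.inr a) D v hv)))

include hd0 in
/-- The fibre of a simple `AV`-module has no proper subspace stable under the linear jets. -/
lemma fib_eq_bot_or_eq_top (hs : AVIsSimple ρ) {N : Submodule ℂ (fib ρ l)}
    (hlin : ∀ v ∈ N, ∀ s q D, fibJet hsup s q D v = linPart (fibJet hsup) s q D v)
    (hN : ∀ x D, ∀ v ∈ N, fibJet hsup (glExp x).1 (glExp x).2 D v ∈ N) : N = ⊥ ∨ N = ⊤ := by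
  set K := Submodule.span ℂ {z : ρ.M | ∃ s q, ∃ v ∈ N, z = aOp ρ s q v} with hKdef
  have hK : ∀ s q, ∀ v ∈ N, aOp ρ s q v ∈ K := fun s q v hv =>
    Submodule.subset_span ⟨s, q, v, hv, rfl⟩
  have stable : ∀ T : Module.End ℂ ρ.M, (∀ s q, ∀ v ∈ N, T (aOp ρ s q v) ∈ K) →
      ∀ z ∈ K, T z ∈ K := by
    intro T hT z hz
    have : K ≤ K.comap T := by
      refine Submodule.span_le.mpr ?_
      rintro _ ⟨s, q, v, hv, rfl⟩
      exact hT s q v hv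
    exact this hz
  have haOp : ∀ p r, ∀ z ∈ K, aOp ρ p r z ∈ K := fun p r => stable _ fun s q v hv => by
    rw [aOp_aOp]
    exact K.smul_mem _ (hK _ _ v hv)
  have hinv : AVInvariant ρ K := by
    refine ⟨?_, fun f => haOp f.1 f.2⟩
    rintro ⟨s, q, D⟩
    refine stable (gOp ρ s q D) fun p r v hv => ?_
    have h := congrArg (fun T : Module.End ℂ ρ.M => T v) (gOp_mul_aOp ρ s q D p r)
    simp only [LinearMap.add_apply, Module.End.mul_apply, LinearMap.smul_apply] at h
    rw [h, gOp_fib hsup hd0 (hlin v hv) s D _ q rfl]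
    exact add_mem (K.smul_mem _ (hK _ _ v hv))
      (K.smul_mem _ (haOp _ _ _ (fibFormula_mem hsup hK hN s q D hv)))
  rcases hs.2 K hinv with h | h
  · left
    refine eq_bot_iff.mpr fun v hv => ?_
    have := hK 0 gnil v hv
    rw [h, Submodule.mem_bot, aOp_one] at this
    exact (Submodule.mem_bot ℂ).mpr (Subtype.ext this)
  · right
    have hproj : K ≤ N.comap (fibProj hsup) := by
      refine Submodule.span_le.mpr ?_
      rintro _ ⟨s, q, v, hv, rfl⟩
      change fibProj hsup (aOp ρ s q v) ∈ N
      rw [fibProj_aOp_coe]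
      exact N.smul_mem _ hv
    refine eq_top_iff.mpr fun v _ => ?_
    have : (v : ρ.M) ∈ K := h ▸ trivial
    simpa [fibProj_coe] using hproj this

include hsup in
lemma nontrivial_fib [Nontrivial ρ.M] : Nontrivial (fib ρ l) := by
  by_contra h
  rw [not_nontrivial_iff_subsingleton] at h
  obtain ⟨z, hz⟩ := exists_ne (0 : ρ.M)
  exact hz ((fibEquiv hsup).symm.injective (Subsingleton.elim _ _))

include hd0 in
lemma jetInvariants_fibJet_eq_top (hfr : IsFiniteRank ρ) (hs : AVIsSimple ρ) :
    jetInvariants (fibJet hsup) = ⊤ := by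
  have := finiteDimensional_fib hsup hfr
  have : Nontrivial ρ.M := nontrivial_of_ne _ _ hs.1.choose_spec
  have := nontrivial_fib hsup
  have hB := isJet_fibJet hsup
  refine (fib_eq_bot_or_eq_top hsup hd0 hs (fun v hv s q D => hB.jet_apply hv s q D)
    fun x D v hv => ?_).resolve_left (positiveInvariants_ne_bot _ _)
  rw [hB.jet_apply hv]
  exact hB.linPart_apply_mem hv _ _ _

include hd0 in
lemma fibJet_eq_linPart (hfr : IsFiniteRank ρ) (hs : AVIsSimple ρ) (v : fib ρ l) (s : LExp m)
    (q : GExp n) (D : Dir m n true) :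
    fibJet hsup s q D v = linPart (fibJet hsup) s q D v := by
  have := finiteDimensional_fib hsup hfr
  exact (isJet_fibJet hsup).jet_apply
    (jetInvariants_fibJet_eq_top hsup hd0 hfr hs ▸ Submodule.mem_top) s q D

include hd0 in
lemma fibJet_glExp_d0 (hfr : IsFiniteRank ρ) (hs : AVIsSimple ρ) (x : GlIdx m n) :
    fibJet hsup (glExp x).1 (glExp x).2 .d0 = 0 := by
  have hB := isJet_fibJet hsup
  ext1 v
  have hv : v ∈ jetInvariants (fibJet hsup) :=
    jetInvariants_fibJet_eq_top hsup hd0 hfr hs ▸ Submodule.mem_top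
  cases x with
  | inl i => exact mem_positiveInvariants.mp hv 0 _ (hB.single_d0_mem i)
  | inr a => exact mem_positiveInvariants.mp hv 1 _ (hB.gone_d0_mem a)

include hd0 in
lemma isSimple_glRep (hfr : IsFiniteRank ρ) (hs : AVIsSimple ρ) :
    (isJet_fibJet hsup).glRep.IsSimple := by
  have : Nontrivial ρ.M := nontrivial_of_ne _ _ hs.1.choose_spec
  have := nontrivial_fib hsup
  refine ⟨exists_ne (0 : fib ρ l), fun N hN => ?_⟩
  refine fib_eq_bot_or_eq_top (N := N) hsup hd0 hs
    (fun v _ => fibJet_eq_linPart hsup hd0 hfr hs v) fun x D v hv => ?_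
  cases D with
  | di i => exact hN x (.inl i) v hv
  | pa a => exact hN x (.inr a) v hv
  | d0 =>
    rw [fibJet_glExp_d0 hsup hd0 hfr hs, LinearMap.zero_apply]
    exact N.zero_mem

lemma neg_one_pow_mul_mulSgn (k : ℕ) (f g : GExp n) :
    (-1 : ℂ) ^ ((gdeg f + k) * gdeg g) * mulSgn g f = (-1) ^ (k * gdeg g) * mulSgn f g := by
  have h : ((-1 : ℂ) ^ (gdeg f * gdeg g)) * (-1) ^ (gdeg f * gdeg g) = 1 := by
    rw [← mul_pow]; simp
  rw [mulSgn_swap g f, add_mul, pow_add, mul_comm (gdeg g)]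
  linear_combination ((-1 : ℂ) ^ (k * gdeg g) * mulSgn f g) * h

lemma neg_one_pow_mul_mulSgn_derE (k : ℕ) (a : Fin n) (f g : GExp n) :
    (-1 : ℂ) ^ ((gdeg f + k) * gdeg g) * (derC a f * mulSgn g (derE a f))
      = (-1) ^ ((k + 1) * gdeg g) * (derC a f * mulSgn (derE a f) g) := by
  by_cases ha : f a = true
  · have h := neg_one_pow_mul_mulSgn (k + 1) (derE a f) g
    rw [← gdeg_derE ha, add_assoc, add_comm 1 k]
    linear_combination derC a f * h
  · simp [derC_of_false (by simpa using ha : f a = false)]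

include hd0 in
lemma gOp_aOp_fib {v : fib ρ l} (hv : ∀ s q D, fibJet hsup s q D v
      = linPart (fibJet hsup) s q D v) (s : LExp m) (f : GExp n) (D : Dir m n true) (r : LExp m)
    (g : GExp n) :
    gOp ρ s f D (aOp ρ r g v)
      = (dco D r g * mulSgn f (deG D g)) • aOp ρ (r + s) (xorE f (deG D g)) v
        + (fibScalar l l0 D * ((-1) ^ (dpar D * gdeg g) * mulSgn f g)) •
            aOp ρ (r + s) (xorE f g) v
        + (∑ i, ((s i : ℂ) * ((-1) ^ (dpar D * gdeg g) * mulSgn f g)) •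
            aOp ρ (r + s) (xorE f g) (fibJet hsup (Pi.single i 1) gnil D v))
        + ∑ a, ((-1 : ℂ) ^ (gdeg f + 1) * ((-1) ^ ((dpar D + 1) * gdeg g) *
              (derC a f * mulSgn (derE a f) g))) •
            aOp ρ (r + s) (xorE (derE a f) g) (fibJet hsup 0 (gone a) D v) := by
  have h := congrArg (fun T : Module.End ℂ ρ.M => T v) (gOp_mul_aOp ρ s f D r g)
  simp only [LinearMap.add_apply, Module.End.mul_apply, LinearMap.smul_apply] at h
  rw [h, gOp_fib hsup hd0 hv s D _ f rfl, fibFormula]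
  simp only [map_add, map_smul, map_sum, aOp_aOp, smul_add, Finset.smul_sum, smul_smul, bpar,
    ← neg_one_pow_mul_mulSgn, ← neg_one_pow_mul_mulSgn_derE, ← add_assoc, add_comm r s,
    xorE_comm g]
  congr 1
  · congr 1
    · congr 2
      ring
    · exact Finset.sum_congr rfl fun i _ => by congr 1; ring
  · exact Finset.sum_congr rfl fun a _ => by congr 1; ring

lemma fibMap_eq_sum (z : ABasis m n →₀ fib ρ l) :
    fibMap ρ l z = z.sum fun x v => aOp ρ x.1 x.2 v := by
  rw [fibMap, Finsupp.lsum_apply]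
  rfl

lemma fibMap_tmA (f : ABasis m n) (z : TModule (isJet_fibJet hsup).glRep) :
    fibMap ρ l (tmA f z) = aOp ρ f.1 f.2 (fibMap ρ l z) := by
  rw [fibMap_eq_sum z, tmA, map_finsuppSum, map_finsuppSum]
  refine Finsupp.sum_congr fun x _ => ?_
  rw [map_smul, fibMap_single, aOp_aOp]

include hd0 in
lemma fibMap_tmAct (hfr : IsFiniteRank ρ) (hs : AVIsSimple ρ) (s : LExp m) (f : GExp n)
    (D : Dir m n true) (z : TModule (isJet_fibJet hsup).glRep) :
    fibMap ρ l (tmAct (isJet_fibJet hsup).glRep l l0 (s, f, D) z)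
      = gOp ρ s f D (fibMap ρ l z) := by
  have hd := fibJet_glExp_d0 hsup hd0 hfr hs
  have hl := fun v => gOp_aOp_fib hsup hd0 (fibJet_eq_linPart hsup hd0 hfr hs v)
  rw [fibMap_eq_sum z, map_finsuppSum]
  cases D with
  | di j =>
    rw [tmAct, map_finsuppSum]
    refine Finsupp.sum_congr fun x _ => ?_
    rw [hl]
    simp only [map_add, map_sum, map_smul, fibMap_single, dco, deG, dpar, fibScalar, zero_mul,
      pow_zero, one_mul, zero_add, add_mul, add_smul]
    congr 1
    refine Finset.sum_congr rfl fun a _ => ?_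
    congr 1
    ring
  | pa b =>
    rw [tmAct, map_finsuppSum]
    refine Finsupp.sum_congr fun x _ => ?_
    rw [hl]
    have h2 : (-1 : ℂ) ^ ((1 + 1) * gdeg x.2) = 1 := by rw [pow_mul]; simp
    simp only [map_add, map_sum, map_smul, fibMap_single, dco, deG, dpar, fibScalar, zero_mul,
      one_mul, zero_smul, add_zero, h2]
    congr 1
    · congr 1
      refine Finset.sum_congr rfl fun i _ => ?_
      congr 1
      ring
    · refine Finset.sum_congr rfl fun a _ => ?_
      congr 1
      ring
  | d0 =>
    rw [tmAct, map_finsuppSum]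
    refine Finsupp.sum_congr fun x _ => ?_
    have hd1 := fun i => hd (.inl i)
    have hd2 := fun a => hd (.inr a)
    simp only [glExp] at hd1 hd2
    rw [hl]
    simp [hd1, hd2, fibMap_single, dco, dpar, fibScalar]

end Fibre

section WeightData

variable {m n : ℕ} {ρ : AVRep m n true}

/-- On a simple weight `AV`-module `d_0` acts by a scalar and the weights lie in one coset. -/
lemma exists_weightData (hw : IsWeightG ρ.g) (hs : AVIsSimple ρ) :
    ∃ (l : Fin m → ℂ) (l0 : ℂ), (⨆ s, wsp ρ l s = ⊤) ∧
      ∀ v : ρ.M, gOp ρ 0 gnil .d0 v = l0 • v := by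
  obtain ⟨lam, u, hu, hu0⟩ : ∃ lam, ∃ u ∈ wtG ρ.g lam, u ≠ 0 := by
    by_contra! hc
    obtain ⟨v, hv⟩ := hs.1
    have hbot : (⨆ lam, wtG ρ.g lam) = ⊥ :=
      iSup_eq_bot.mpr fun lam => eq_bot_iff.mpr fun u hu => hc lam u hu
    rw [IsWeightG, hbot] at hw
    have : v ∈ (⊥ : Submodule ℂ ρ.M) := hw ▸ Submodule.mem_top
    exact hv this
  have hu' : ∀ h, ρ.g (hB m n true h) u = lam h • u := by
    simpa [wtG, sub_eq_zero] using hu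
  have hdi : ∀ i, gOp ρ 0 gnil (.di i) u = lam (.inl i) • u := fun i => hu' (.inl i)
  refine ⟨fun i => lam (.inl i), lam (.inr (0 : Fin 1)), ?_, ?_⟩
  · have hbot : (⨆ s, wsp ρ (fun i => lam (.inl i)) s) ≠ ⊥ := by
      refine (Submodule.ne_bot_iff _).mpr ⟨u, ?_, hu0⟩
      refine Submodule.mem_iSup_of_mem 0 (mem_wsp.mpr fun i => ?_)
      simpa using hdi i
    have stable : ∀ T : Module.End ℂ ρ.M, ∀ p : LExp m,
        (∀ s, ∀ v ∈ wsp ρ (fun i => lam (.inl i)) s, T v ∈ wsp ρ (fun i => lam (.inl i)) (p + s)) →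
        ∀ v ∈ ⨆ s, wsp ρ (fun i => lam (.inl i)) s,
          T v ∈ ⨆ s, wsp ρ (fun i => lam (.inl i)) s := by
      intro T p hT
      have : (⨆ s, wsp ρ (fun i => lam (.inl i)) s)
          ≤ (⨆ s, wsp ρ (fun i => lam (.inl i)) s).comap T :=
        iSup_le fun s v hv => Submodule.mem_iSup_of_mem (p + s) (hT s v hv)
      exact fun v hv => this hv
    refine (hs.2 _ ⟨?_, ?_⟩).resolve_left hbot
    · rintro ⟨p, q, D⟩
      exact stable (gOp ρ p q D) p fun s v hv => gOp_mem_wsp p q D hv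
    · rintro ⟨p, q⟩
      exact stable (aOp ρ p q) p fun s v hv => aOp_mem_wsp p q hv
  · set K := LinearMap.ker (gOp ρ 0 gnil .d0 - lam (.inr (0 : Fin 1)) • (1 : Module.End ℂ ρ.M)) with hK
    have memK : ∀ v, v ∈ K ↔ gOp ρ 0 gnil .d0 v = lam (.inr (0 : Fin 1)) • v := fun v => by
      simp [hK, sub_eq_zero]
    have htop : K = ⊤ := by
      refine (hs.2 K ⟨?_, ?_⟩).resolve_left ?_
      · rintro ⟨p, q, D⟩ v hv
        change gOp ρ p q D v ∈ K
        have h := congrArg (fun T : Module.End ℂ ρ.M => T v) (gOp_bracket ρ 0 gnil .d0 p q D)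
        have e : dco (.d0 : Dir m n true) p q = 0 := rfl
        simp only [e, dco_zero_gnil, bpar, dpar, gdeg_gnil, mul_zero, zero_mul, zero_smul, sub_zero,
          add_zero, pow_zero, one_smul, LinearMap.sub_apply, Module.End.mul_apply,
          LinearMap.zero_apply] at h
        rw [memK, sub_eq_zero.mp h, (memK v).mp hv, map_smul]
      · rintro ⟨p, q⟩ v hv
        change aOp ρ p q v ∈ K
        have h := congrArg (fun T : Module.End ℂ ρ.M => T v) (gOp_mul_aOp ρ 0 gnil .d0 p q)
        have e : dco (.d0 : Dir m n true) p q = 0 := rfl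
        simp only [e, bpar, dpar, gdeg_gnil, zero_mul, zero_smul, zero_add, pow_zero, one_smul,
          Module.End.mul_apply] at h
        rw [memK, h, (memK v).mp hv, map_smul]
      · exact (Submodule.ne_bot_iff _).mpr ⟨u, (memK u).mpr (hu' (.inr (0 : Fin 1))), hu0⟩
    exact fun v => (memK v).mp (htop ▸ Submodule.mem_top)

end WeightData

/-- Let `V = W(m,n) ⋉ A d_0` and `A = R_m ⊗ Λ`.  Every simple
weight `AV`-module `M` of finite rank is a tensor module for `W(m,n)`,
`M = A ⊗ V'` for a simple finite-dimensional `gl(m,n)`-module `V'` with support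
`λ + ℤ^m`, on which `A d_0` acts by multiplication on the left tensor factor:
`(t^s f d_0)(t^r g ⊗ v) = λ_0 t^{r+s} f g ⊗ v` for some scalar `λ_0 ∈ ℂ`
(this `d_0`-action is part of the formulas `tmAct σ lam lam0`). -/
theorem simple_weight_finiteRank_is_tensor_ext (m n : ℕ) (ρ : AVRep m n true)
    (hw : IsWeightG ρ.g) (hfr : IsFiniteRank ρ) (hs : AVIsSimple ρ) :
    ∃ σ : GlRep m n, FiniteDimensional ℂ σ.V ∧ σ.IsSimple ∧
      ∃ (lam : Fin m → ℂ) (lam0 : ℂ) (e : ρ.M ≃ₗ[ℂ] TModule σ),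
        (∀ (x : WBasis m n true) (v : ρ.M),
            e (ρ.act (sng x) v) = tmAct σ lam lam0 x (e v)) ∧
        (∀ (f : ABasis m n) (v : ρ.M),
            e (ρ.aact (asng f) v) = tmA f (e v)) := by
  obtain ⟨l, l0, hsup, hd0⟩ := exists_weightData hw hs
  refine ⟨(isJet_fibJet hsup).glRep, finiteDimensional_fib hsup hfr,
    isSimple_glRep hsup hd0 hfr hs, l, l0, (fibEquiv hsup).symm, ?_, ?_⟩
  · rintro ⟨s, q, D⟩ v
    refine (LinearEquiv.symm_apply_eq (fibEquiv hsup)).mpr ?_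
    rw [fibEquiv_apply, fibMap_tmAct hsup hd0 hfr hs, ← fibEquiv_apply hsup,
      LinearEquiv.apply_symm_apply]
    rfl
  · rintro f v
    refine (LinearEquiv.symm_apply_eq (fibEquiv hsup)).mpr ?_
    rw [fibEquiv_apply, fibMap_tmA, ← fibEquiv_apply hsup, LinearEquiv.apply_symm_apply]
    rfl

end WSuper
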